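/- arXiv:1812.04876 — 11 statements merged into one kernel-verified Lean document; each statement's English description precedes it below -/
import Mathlib

section
/- For every real δ > (√5−1)/2, setting a = δ²/(δ²+δ−1), the supremum over all ε₁ > 0 and ε₂ > 0 of min{ ε₁/(δ(ε₁²+ε₂+1)), (δ²+δ−1)ε₁ε₂/(δ³(1+ε₂)) } equals √(a+1)/(δ(a+1+√(a+1))), and this value is attained at ε₁ = √(a+1), ε₂ = √(a+1)−1 (so the supremum is a maximum). -/
theorem sq_add_sub_one_pos_of_golden_lt {δ : ℝ} (hδ : (Real.sqrt 5 - 1) / 2 < δ) :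
    0 < δ ^ 2 + δ - 1 := by
  nlinarith [Real.sq_sqrt (show (0 : ℝ) ≤ 5 by norm_num), Real.sqrt_nonneg 5]

/-- The normalized form of the two-parameter optimization: both terms cannot exceed `1 / (s + 1)`. -/
theorem min_div_le_one_div_add_one {s x y : ℝ} (hs : 1 < s) (hx : 0 < x) (hy : 0 < y) :
    min (x / (x ^ 2 + y + 1)) (x * y / ((s ^ 2 - 1) * (1 + y))) ≤ 1 / (s + 1) := by
  by_contra! h
  obtain ⟨h₁, h₂⟩ := lt_min_iff.mp h
  have hs' : 0 < s ^ 2 - 1 := by nlinarith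
  rw [div_lt_div_iff₀ (by positivity) (by positivity)] at h₁ h₂
  have h₃ : (s - 1) * (1 + y) < x * y := by
    have : (s + 1) * ((s - 1) * (1 + y)) < (s + 1) * (x * y) := by linarith
    exact lt_of_mul_lt_mul_left this (by linarith)
  have h₄ : 0 < x - s + 1 := by
    by_contra! hle
    nlinarith [mul_nonneg (sub_nonneg.mpr hle) hy.le]
  have h₅ : (x - s + 1) * (1 + y) < (x - s + 1) * (x * (s + 1 - x)) :=
    mul_lt_mul_of_pos_left (by linarith) h₄
  nlinarith [mul_nonneg hx.le (sq_nonneg (x - s))]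


/-- For every real δ > (√5−1)/2, setting a = δ²/(δ²+δ−1), the supremum over all
ε₁ > 0 and ε₂ > 0 of min{ ε₁/(δ(ε₁²+ε₂+1)), (δ²+δ−1)ε₁ε₂/(δ³(1+ε₂)) } equals
√(a+1)/(δ(a+1+√(a+1))), and it is attained at ε₁ = √(a+1), ε₂ = √(a+1)−1. -/
theorem stmt0 (δ : ℝ) (hδ : (Real.sqrt 5 - 1) / 2 < δ) :
    let a : ℝ := δ ^ 2 / (δ ^ 2 + δ - 1)
    IsGreatest
      {v : ℝ | ∃ ε₁ > (0 : ℝ), ∃ ε₂ > (0 : ℝ),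
        v = min (ε₁ / (δ * (ε₁ ^ 2 + ε₂ + 1)))
              ((δ ^ 2 + δ - 1) * ε₁ * ε₂ / (δ ^ 3 * (1 + ε₂)))}
      (Real.sqrt (a + 1) / (δ * (a + 1 + Real.sqrt (a + 1)))) ∧
    min (Real.sqrt (a + 1) / (δ * ((Real.sqrt (a + 1)) ^ 2 + (Real.sqrt (a + 1) - 1) + 1)))
        ((δ ^ 2 + δ - 1) * Real.sqrt (a + 1) * (Real.sqrt (a + 1) - 1) /
          (δ ^ 3 * (1 + (Real.sqrt (a + 1) - 1)))) =
      Real.sqrt (a + 1) / (δ * (a + 1 + Real.sqrt (a + 1))) := by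
  intro a
  have hb := sq_add_sub_one_pos_of_golden_lt hδ
  have hδ0 : 0 < δ := by
    have : 1 < Real.sqrt 5 := by
      rw [Real.lt_sqrt] <;> norm_num
    linarith
  have ha : 0 < a := by positivity
  have hab : a * (δ ^ 2 + δ - 1) = δ ^ 2 := div_mul_cancel₀ _ hb.ne'
  have hs2 : Real.sqrt (a + 1) ^ 2 = a + 1 := Real.sq_sqrt (by linarith)
  have hs : 1 < Real.sqrt (a + 1) := by
    rw [Real.lt_sqrt] <;> linarith
  clear_value a
  generalize Real.sqrt (a + 1) = s at hs hs2 ⊢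
  obtain rfl : a = s ^ 2 - 1 := by linarith
  have hs0 : 0 < s := by linarith
  have hval : s / (δ * (s ^ 2 - 1 + 1 + s)) = 1 / (s + 1) / δ := by
    rw [show s ^ 2 - 1 + 1 + s = s * (s + 1) by ring]
    field_simp
  have hfirst (x y : ℝ) : x / (δ * (x ^ 2 + y + 1)) = x / (x ^ 2 + y + 1) / δ := by
    rw [mul_comm, div_div]
  have hsecond (x y : ℝ) : (δ ^ 2 + δ - 1) * x * y / (δ ^ 3 * (1 + y)) =
      x * y / ((s ^ 2 - 1) * (1 + y)) / δ := by
    generalize δ ^ 2 + δ - 1 = b at hb hab ⊢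
    rw [show δ ^ 3 = δ * δ ^ 2 by ring, ← hab]
    field_simp
  have hmax : min (s / (δ * (s ^ 2 + (s - 1) + 1)))
      ((δ ^ 2 + δ - 1) * s * (s - 1) / (δ ^ 3 * (1 + (s - 1)))) =
      s / (δ * (s ^ 2 - 1 + 1 + s)) := by
    have h : s * (s - 1) / ((s ^ 2 - 1) * (1 + (s - 1))) = 1 / (s + 1) := by
      rw [div_eq_div_iff (mul_pos ha (by linarith)).ne' (by positivity)]
      ring
    rw [hsecond, h, ← hval, show s ^ 2 + (s - 1) + 1 = s ^ 2 - 1 + 1 + s by ring, min_self]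
  refine ⟨⟨⟨s, hs0, s - 1, by linarith, hmax.symm⟩, ?_⟩, hmax⟩
  rintro v ⟨x, hx, y, hy, rfl⟩
  rw [hval, hfirst, hsecond, min_div_div_right hδ0.le]
  exact div_le_div_of_nonneg_right (min_div_le_one_div_add_one hs hx hy) hδ0.le
end

section
/- The supremum over all real δ > (√5−1)/2 of κ(δ) = √(a(δ)+1)/(δ·(a(δ)+1+√(a(δ)+1))), where a(δ) = δ²/(δ²+δ−1), equals 1/2, and it is attained at δ = √3−1 (at which point a(δ) = 2). -/
/-- a(δ) = δ²/(δ²+δ−1). -/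
noncomputable def aFn (δ : ℝ) : ℝ := δ ^ 2 / (δ ^ 2 + δ - 1)

/-- κ(δ) = √(a(δ)+1) / (δ·(a(δ)+1+√(a(δ)+1))). -/
noncomputable def kappaFn (δ : ℝ) : ℝ :=
  Real.sqrt (aFn δ + 1) / (δ * (aFn δ + 1 + Real.sqrt (aFn δ + 1)))

theorem quadratic_pos {δ : ℝ} (h : (Real.sqrt 5 - 1) / 2 < δ) :
    0 < δ ∧ 0 < δ ^ 2 + δ - 1 := by
  have h5 : Real.sqrt 5 ^ 2 = 5 := Real.sq_sqrt (by norm_num)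
  have h1 : 1 < Real.sqrt 5 := Real.lt_sqrt_of_sq_lt (by norm_num)
  exact ⟨by linarith, by nlinarith⟩

theorem kappaFn_eq {δ : ℝ} (ha : 0 < aFn δ + 1) :
    kappaFn δ = 1 / (δ * (Real.sqrt (aFn δ + 1) + 1)) := by
  have hs : 0 < Real.sqrt (aFn δ + 1) := Real.sqrt_pos.2 ha
  have hden : δ * (aFn δ + 1 + Real.sqrt (aFn δ + 1)) =
      Real.sqrt (aFn δ + 1) * (δ * (Real.sqrt (aFn δ + 1) + 1)) := by
    linear_combination -δ * Real.sq_sqrt ha.le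
  rw [kappaFn, hden, div_mul_eq_div_div, div_self hs.ne']

theorem kappaFn_le_half {δ : ℝ} (h : (Real.sqrt 5 - 1) / 2 < δ) : kappaFn δ ≤ 1 / 2 := by
  obtain ⟨hδ, hq⟩ := quadratic_pos h
  have ha : 0 < aFn δ + 1 := by unfold aFn; positivity
  have hs : (2 - δ) / δ ≤ Real.sqrt (aFn δ + 1) := by
    apply Real.le_sqrt_of_sq_le
    have key : aFn δ + 1 - ((2 - δ) / δ) ^ 2 =
        (δ ^ 2 + 2 * δ - 2) ^ 2 / ((δ ^ 2 + δ - 1) * δ ^ 2) := by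
      have hq' : δ * (δ + 1) - 1 ≠ 0 := by convert hq.ne' using 1; ring
      unfold aFn
      field_simp
      ring
    have hnonneg : 0 ≤ (δ ^ 2 + 2 * δ - 2) ^ 2 / ((δ ^ 2 + δ - 1) * δ ^ 2) := by positivity
    linarith
  rw [div_le_iff₀ hδ] at hs
  rw [kappaFn_eq ha]
  exact one_div_le_one_div_of_le two_pos (by linarith)

theorem aFn_sqrt_three_sub_one : aFn (Real.sqrt 3 - 1) = 2 := by
  have h3 : Real.sqrt 3 ^ 2 = 3 := Real.sq_sqrt (by norm_num)
  have hlt : Real.sqrt 3 < 2 := (Real.sqrt_lt' two_pos).2 (by norm_num)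
  have hne : (Real.sqrt 3 - 1) ^ 2 + (Real.sqrt 3 - 1) - 1 ≠ 0 := by
    nlinarith
  rw [aFn, div_eq_iff hne]
  linear_combination -h3

theorem kappaFn_sqrt_three_sub_one : kappaFn (Real.sqrt 3 - 1) = 1 / 2 := by
  have h3 : Real.sqrt 3 ^ 2 = 3 := Real.sq_sqrt (by norm_num)
  rw [kappaFn_eq (by rw [aFn_sqrt_three_sub_one]; norm_num), aFn_sqrt_three_sub_one,
    show (2 : ℝ) + 1 = 3 by norm_num]
  congr 1
  linear_combination h3

/-- The supremum over all real δ > (√5−1)/2 of κ(δ) equals 1/2, attained at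
δ = √3−1 (at which point a(δ) = 2). -/
theorem stmt1 :
    IsGreatest {v : ℝ | ∃ δ : ℝ, (Real.sqrt 5 - 1) / 2 < δ ∧ v = kappaFn δ} (1 / 2) ∧
    kappaFn (Real.sqrt 3 - 1) = 1 / 2 ∧ aFn (Real.sqrt 3 - 1) = 2 := by
  refine ⟨⟨⟨Real.sqrt 3 - 1, ?_, kappaFn_sqrt_three_sub_one.symm⟩, ?_⟩,
    kappaFn_sqrt_three_sub_one, aFn_sqrt_three_sub_one⟩
  · have h5 : Real.sqrt 5 < 2.4 := (Real.sqrt_lt' (by norm_num)).2 (by norm_num)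
    have h3 : 1.7 < Real.sqrt 3 := Real.lt_sqrt_of_sq_lt (by norm_num)
    linarith
  · rintro _ ⟨δ, hδ, rfl⟩
    exact kappaFn_le_half hδ
end

section
/- Let H be a real Hilbert space, g : H → ℝ convex, F : H → H any map, δ > 0 and α ≥ 0. Let x₋, x₀, x₊ ∈ H, y₋ ∈ H, λ₋ > 0, λ₀ > 0, and set y₀ = x₀ + δ(x₀ − x₋). Assume: (i) ⟨x₊ − x₀ + λ₀·F(y₀), x − x₊⟩ ≥ λ₀(g(x₊) − g(x)) for all x ∈ H; (ii) ⟨x₀ − x₋ + λ₋·F(y₋), x − x₀⟩ ≥ λ₋(g(x₀) − g(x)) for all x ∈ H; (iii) λ₀‖F(y₀) − F(y₋)‖ ≤ α‖y₀ − y₋‖. Then for every x ∈ H: ‖x₊ − x‖² ≤ ‖x₀ − x‖² − (λ₀/(δλ₋))(‖y₀ − x₀‖² + ‖x₊ − y₀‖²) + (λ₀/(δλ₋) − 1)‖x₊ − x₀‖² + 2α‖y₀ − y₋‖·‖x₊ − y₀‖ − 2λ₀[(1+δ)g(x₀) − δ·g(x₋) − g(x)] − 2λ₀⟨F(y₀),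 y₀ − x⟩. -/
open scoped RealInnerProductSpace

/-- one-step estimate (Lemma 3 of the paper) for the proximal extrapolated
gradient step. -/
theorem stmt5 {H : Type*} [NormedAddCommGroup H] [InnerProductSpace ℝ H]
    (g : H → ℝ) (hg : ConvexOn ℝ Set.univ g) (F : H → H)
    (δ α : ℝ) (hδ : 0 < δ) (hα : 0 ≤ α)
    (xm x0 xp ym : H) (lm l0 : ℝ) (hlm : 0 < lm) (hl0 : 0 < l0)
    (y0 : H) (hy0 : y0 = x0 + δ • (x0 - xm))
    (hi : ∀ x : H, ⟪xp - x0 + l0 • F y0, x - xp⟫ ≥ l0 * (g xp - g x))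
    (hii : ∀ x : H, ⟪x0 - xm + lm • F ym, x - x0⟫ ≥ lm * (g x0 - g x))
    (hiii : l0 * ‖F y0 - F ym‖ ≤ α * ‖y0 - ym‖) :
    ∀ x : H, ‖xp - x‖ ^ 2 ≤ ‖x0 - x‖ ^ 2
      - (l0 / (δ * lm)) * (‖y0 - x0‖ ^ 2 + ‖xp - y0‖ ^ 2)
      + (l0 / (δ * lm) - 1) * ‖xp - x0‖ ^ 2
      + 2 * α * ‖y0 - ym‖ * ‖xp - y0‖
      - 2 * l0 * ((1 + δ) * g x0 - δ * g xm - g x)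
      - 2 * l0 * ⟪F y0, y0 - x⟫ := by
  intro x
  have polarization (a b c : H) :
      2 * ⟪b - a, c - b⟫ = ‖c - a‖ ^ 2 - ‖b - a‖ ^ 2 - ‖c - b‖ ^ 2 := by
    have h := norm_add_sq_real (b - a) (c - b)
    rw [show b - a + (c - b) = c - a by abel] at h
    linarith
  have hstep := hi x
  rw [inner_add_left, real_inner_smul_left] at hstep
  have hprev : ⟪x0 - xm, xp - y0⟫ + lm * ⟪F ym, xp - y0⟫
      ≥ lm * ((1 + δ) * g x0 - g xp - δ * g xm) := by
    have h₁ := hii xp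
    have h₂ := mul_le_mul_of_nonneg_left (hii xm) hδ.le
    have hsplit : xp - y0 = (xp - x0) + δ • (xm - x0) := by
      rw [hy0]; module
    have key : ⟪x0 - xm, xp - y0⟫ + lm * ⟪F ym, xp - y0⟫
        = ⟪x0 - xm + lm • F ym, xp - x0⟫ + δ * ⟪x0 - xm + lm • F ym, xm - x0⟫ := by
      rw [← real_inner_smul_left, ← inner_add_left, hsplit, inner_add_right,
        real_inner_smul_right]
    rw [key]
    linarith
  have hextra : ⟪y0 - x0, xp - y0⟫ = δ * ⟪x0 - xm, xp - y0⟫ := by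
    rw [← real_inner_smul_left]
    congr 1
    rw [hy0]; abel
  have hscaled : l0 / (δ * lm) * ⟪y0 - x0, xp - y0⟫ + l0 * ⟪F ym, xp - y0⟫
      ≥ l0 * ((1 + δ) * g x0 - g xp - δ * g xm) := by
    have h := mul_le_mul_of_nonneg_left hprev (div_pos hl0 hlm).le
    have hk : l0 / (δ * lm) * δ = l0 / lm := by field_simp
    have hl : l0 / lm * lm = l0 := div_mul_cancel₀ l0 hlm.ne'
    rw [mul_add, ← mul_assoc, ← mul_assoc, hl] at h
    rw [hextra, ← mul_assoc, hk]
    exact h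
  have hcross : l0 * ⟪F y0 - F ym, y0 - xp⟫ ≤ α * ‖y0 - ym‖ * ‖xp - y0‖ := by
    have h₁ := mul_le_mul_of_nonneg_left (real_inner_le_norm (F y0 - F ym) (y0 - xp)) hl0.le
    have h₂ := mul_le_mul_of_nonneg_right hiii (norm_nonneg (xp - y0))
    rw [norm_sub_rev y0 xp] at h₁
    linarith
  have hF : ⟪F y0, x - xp⟫
      = -⟪F y0, y0 - x⟫ + ⟪F y0 - F ym, y0 - xp⟫ - ⟪F ym, xp - y0⟫ := by
    simp only [inner_sub_left, inner_sub_right]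
    ring
  rw [hF] at hstep
  have hpol := polarization x0 xp x
  rw [norm_sub_rev x x0, norm_sub_rev x xp] at hpol
  have hpol' := congrArg (l0 / (δ * lm) * ·) (polarization x0 y0 xp)
  linarith
end

section
/- Let H be a real Hilbert space, g : H → ℝ convex, F : H → H monotone, δ > 0 and α ≥ 0. Let x₋, x₀, x₊ ∈ H, y₋ ∈ H, λ₋ > 0, 0 < λ₀ ≤ λ₋, and set y₀ = x₀ + δ(x₀ − x₋). Assume the proximal variational inequalities (i) ⟨x₊ − x₀ + λ₀·F(y₀), x − x₊⟩ ≥ λ₀(g(x₊) − g(x)) for all x ∈ H and (ii) ⟨x₀ − x₋ + λ₋·F(y₋), x − x₀⟩ ≥ λ₋(g(x₀) − g(x)) for all x ∈ H, together with (iii) λ₀‖F(y₀) − F(y₋)‖ ≤ α‖y₀ − y₋‖. Let x̄ ∈ H satisfy ⟨F(x̄), y − x̄⟩ + g(y) − g(x̄) ≥ 0 for all y ∈ H. Then for all ε₁, ε₂ > 0: ‖x₊ − x̄‖² + 2λ₀(1+δ)Φ(x̄, x₀) ≤ ‖x₀ − x̄‖² + 2λ₋(1+δ)Φ(x̄, x₋)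 + [ (α/ε₁)(1+1/ε₂) − λ₀/(δλ₋) ]‖x₀ − y₀‖² + ( λ₀/(δλ₋) − 1 )‖x₊ − x₀‖² + ( ε₁α − λ₀/(δλ₋) )‖x₊ − y₀‖² + ((1+ε₂)/ε₁)·α·‖x₀ − y₋‖². -/
open scoped RealInnerProductSpace

/-- Φ(x,y) := ⟨F(x), y−x⟩ + g(y) − g(x). -/
noncomputable def Phi {H : Type*} [NormedAddCommGroup H] [InnerProductSpace ℝ H]
    (F : H → H) (g : H → ℝ) (x y : H) : ℝ := ⟪F x, y - x⟫ + g y - g x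

/-- Young's inequality for two reals with weight `ε`. -/
theorem two_mul_mul_le_weighted_sq_add_sq (a b : ℝ) {ε : ℝ} (hε : 0 < ε) :
    2 * a * b ≤ 1 / ε * a ^ 2 + ε * b ^ 2 := by
  have h : 1 / ε * a ^ 2 + ε * b ^ 2 - 2 * a * b = 1 / ε * (a - ε * b) ^ 2 := by
    field_simp
    ring
  have : 0 ≤ 1 / ε * (a - ε * b) ^ 2 := by positivity
  linarith

/-- The triangle inequality for squared norms, weighted by Young's inequality. -/
theorem norm_sub_sq_le_weighted {E : Type*} [SeminormedAddCommGroup E] (a b c : E)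
    {ε : ℝ} (hε : 0 < ε) :
    ‖a - c‖ ^ 2 ≤ (1 + 1 / ε) * ‖b - a‖ ^ 2 + (1 + ε) * ‖b - c‖ ^ 2 := by
  have htri : ‖a - c‖ ≤ ‖b - a‖ + ‖b - c‖ := by
    rw [norm_sub_rev b a]
    exact norm_sub_le_norm_sub_add_norm_sub a b c
  have hyoung := two_mul_mul_le_weighted_sq_add_sq ‖b - a‖ ‖b - c‖ hε
  have hsq := pow_le_pow_left₀ (norm_nonneg _) htri 2
  linarith

section

variable {H : Type*} [NormedAddCommGroup H] [InnerProductSpace ℝ H]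

/-- The three-point identity. -/
theorem two_mul_inner_sub_sub (a b c : H) :
    2 * ⟪a - b, c - a⟫ = ‖b - c‖ ^ 2 - ‖a - c‖ ^ 2 - ‖a - b‖ ^ 2 := by
  have h : b - c = (a - c) - (a - b) := by abel
  rw [h, norm_sub_sq_real, ← neg_sub a c, inner_neg_right, real_inner_comm]
  ring

/-- An extrapolated point turns `Phi` into an affine combination of its values, up to `g`. -/
theorem inner_extrapolation_eq_Phi (F : H → H) (g : H → ℝ) (δ : ℝ) (z x w : H) :
    ⟪F z, z - (x + δ • (x - w))⟫ + (g z - (1 + δ) * g x + δ * g w) =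
      δ * Phi F g z w - (1 + δ) * Phi F g z x := by
  have h : z - (x + δ • (x - w)) = δ • (w - z) - (1 + δ) • (x - z) := by module
  rw [h, inner_sub_right, real_inner_smul_right, real_inner_smul_right, Phi, Phi]
  ring

/-- A proximal step from `w` to `x`, tested at `p` and `w`, seen from the extrapolated point. -/
theorem proximal_extrapolation_bound {g : H → ℝ} {δ l : ℝ} (hδ : 0 < δ) (hl : 0 < l)
    {w x p y v : H} (hy : y = x + δ • (x - w))
    (h : ∀ z : H, ⟪x - w + l • v, z - x⟫ ≥ l * (g x - g z)) :
    2 * ((1 + δ) * g x - g p - δ * g w) ≤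
      1 / (δ * l) * (‖p - x‖ ^ 2 - ‖x - y‖ ^ 2 - ‖p - y‖ ^ 2) + 2 * ⟪v, p - y⟫ := by
  have hsum : l * ((1 + δ) * g x - g p - δ * g w) ≤ ⟪x - w + l • v, p - y⟫ := by
    have hpy : p - y = (p - x) + δ • (w - x) := by rw [hy]; module
    rw [hpy, inner_add_right, real_inner_smul_right]
    have hw := mul_le_mul_of_nonneg_left (h w) hδ.le
    have hp := h p
    linarith
  have hthree : 2 * δ * ⟪x - w, p - y⟫ = ‖p - x‖ ^ 2 - ‖x - y‖ ^ 2 - ‖p - y‖ ^ 2 := by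
    have hyx : y - x = δ • (x - w) := by rw [hy]; abel
    have := two_mul_inner_sub_sub y x p
    rw [norm_sub_rev p x, norm_sub_rev p y, norm_sub_rev x y]
    rw [hyx, real_inner_smul_left, ← hyx] at this
    linarith
  rw [inner_add_left, real_inner_smul_left] at hsum
  rw [← hthree]
  have hid : 1 / (δ * l) * (2 * δ * ⟪x - w, p - y⟫) + 2 * ⟪v, p - y⟫
      = 2 / l * (⟪x - w, p - y⟫ + l * ⟪v, p - y⟫) := by
    field_simp
  have hid' : 2 * ((1 + δ) * g x - g p - δ * g w)
      = 2 / l * (l * ((1 + δ) * g x - g p - δ * g w)) := by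
    field_simp
  rw [hid, hid']
  gcongr

end

/-- one-step estimate against a solution x̄ (Lemma 4 of the paper). -/
theorem stmt6 {H : Type*} [NormedAddCommGroup H] [InnerProductSpace ℝ H]
    (g : H → ℝ) (hg : ConvexOn ℝ Set.univ g) (F : H → H)
    (hmono : ∀ u v : H, 0 ≤ ⟪F u - F v, u - v⟫)
    (δ α : ℝ) (hδ : 0 < δ) (hα : 0 ≤ α)
    (xm x0 xp ym : H) (lm l0 : ℝ) (hlm : 0 < lm) (hl0 : 0 < l0) (hle : l0 ≤ lm)
    (y0 : H) (hy0 : y0 = x0 + δ • (x0 - xm))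
    (hi : ∀ x : H, ⟪xp - x0 + l0 • F y0, x - xp⟫ ≥ l0 * (g xp - g x))
    (hii : ∀ x : H, ⟪x0 - xm + lm • F ym, x - x0⟫ ≥ lm * (g x0 - g x))
    (hiii : l0 * ‖F y0 - F ym‖ ≤ α * ‖y0 - ym‖)
    (xbar : H) (hxbar : ∀ y : H, 0 ≤ ⟪F xbar, y - xbar⟫ + g y - g xbar) :
    ∀ ε₁ ε₂ : ℝ, 0 < ε₁ → 0 < ε₂ →
      ‖xp - xbar‖ ^ 2 + 2 * l0 * (1 + δ) * Phi F g xbar x0 ≤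
        ‖x0 - xbar‖ ^ 2 + 2 * lm * (1 + δ) * Phi F g xbar xm
        + ((α / ε₁) * (1 + 1 / ε₂) - l0 / (δ * lm)) * ‖x0 - y0‖ ^ 2
        + (l0 / (δ * lm) - 1) * ‖xp - x0‖ ^ 2
        + (ε₁ * α - l0 / (δ * lm)) * ‖xp - y0‖ ^ 2
        + ((1 + ε₂) / ε₁) * α * ‖x0 - ym‖ ^ 2 := by
  intro ε₁ ε₂ hε₁ hε₂
  have hstep := hi xbar
  rw [inner_add_left, real_inner_smul_left] at hstep
  have hthree := two_mul_inner_sub_sub xp x0 xbar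
  have hprev := mul_le_mul_of_nonneg_left
    (proximal_extrapolation_bound (p := xp) hδ hlm hy0 hii) hl0.le
  have hmon : l0 * ⟪F y0, xbar - y0⟫ ≤ l0 * ⟪F xbar, xbar - y0⟫ := by
    have := hmono xbar y0
    rw [inner_sub_left] at this
    gcongr
    linarith
  have hext := inner_extrapolation_eq_Phi F g δ xbar x0 xm
  rw [← hy0] at hext
  have hPhi : l0 * δ * Phi F g xbar xm ≤ lm * (1 + δ) * Phi F g xbar xm :=
    mul_le_mul_of_nonneg_right (by nlinarith) (hxbar xm)
  have hsplit : ⟪F y0, xbar - xp⟫ + ⟪F ym, xp - y0⟫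
      = ⟪F y0, xbar - y0⟫ + ⟪F y0 - F ym, y0 - xp⟫ := by
    simp only [inner_sub_left, inner_sub_right]
    ring
  have hlip : l0 * ⟪F y0 - F ym, y0 - xp⟫ ≤ α * ‖y0 - ym‖ * ‖xp - y0‖ := by
    calc l0 * ⟪F y0 - F ym, y0 - xp⟫
        ≤ l0 * (‖F y0 - F ym‖ * ‖y0 - xp‖) := by
          gcongr
          exact real_inner_le_norm _ _
      _ = l0 * ‖F y0 - F ym‖ * ‖xp - y0‖ := by rw [norm_sub_rev y0 xp]; ring
      _ ≤ α * ‖y0 - ym‖ * ‖xp - y0‖ := by gcongr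
  have hyoung := mul_le_mul_of_nonneg_left
    (two_mul_mul_le_weighted_sq_add_sq ‖y0 - ym‖ ‖xp - y0‖ hε₁) hα
  have hweight := mul_le_mul_of_nonneg_left (norm_sub_sq_le_weighted y0 x0 ym hε₂)
    (div_nonneg hα hε₁.le)
  have hcoef : (1 + ε₂) / ε₁ * α = α / ε₁ * (1 + ε₂) := by ring
  have hc : l0 / (δ * lm) = l0 * (1 / (δ * lm)) := by ring
  replace hsplit := congrArg (l0 * ·) hsplit
  replace hext := congrArg (l0 * ·) hext
  rw [hcoef, hc]
  rw [← mul_one_div α ε₁] at hweight ⊢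
  linarith
end

section
/- Let H be a real Hilbert space, g : H → ℝ convex, F : H → H monotone, δ > 0, α ≥ 0. Let x : ℕ → H, y : ℕ → H and λ : ℕ → ℝ be sequences with λ(n) > 0 and λ(n) ≤ λ(n−1) for all n ≥ 1, y(n) = x(n) + δ(x(n) − x(n−1)) for all n ≥ 1, and for all n ≥ 1: ⟨x(n+1) − x(n) + λ(n)·F(y(n)), x − x(n+1)⟩ ≥ λ(n)(g(x(n+1)) − g(x)) for all x ∈ H, and λ(n)‖F(y(n)) − F(y(n−1))‖ ≤ α‖y(n) − y(n−1)‖. Let x̄ ∈ H satisfy Φ(x̄, y) ≥ 0 for all y ∈ H. For ε₁, ε₂ > 0 define a(n) = ‖x(n) − x̄‖² + 2λ(n−1)(1+δ)Φ(x̄, x(n−1)) + ((1+ε₂)/ε₁)·α·‖x(n) − y(n−1)‖² + (1 − λ(n−1)/(δλ(n−2)))‖x(n) − x(n−1)‖² and b(n) = [ λ(n)/(δλ(n−1)) − (ε₁ + (1+ε₂)/ε₁)·α ]‖x(n+1) − y(n)‖² + [ λ(n)/(δλ(n−1)) − (α/ε₁)(1+1/ε₂) + (1/δ²)(1 − λ(n−1)/(δλ(n−2)))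 ]‖x(n) − y(n)‖². Then a(n+1) ≤ a(n) − b(n) for all n ≥ 2. -/
open scoped RealInnerProductSpace

section InnerProductSpace

variable {H : Type*} [NormedAddCommGroup H] [InnerProductSpace ℝ H]

theorem norm_add_sq_le_weighted (u v : H) {ε : ℝ} (hε : 0 < ε) :
    ‖u + v‖ ^ 2 ≤ (1 + ε) * ‖u‖ ^ 2 + (1 + 1 / ε) * ‖v‖ ^ 2 := by
  have h : 0 ≤ ‖ε • u - v‖ ^ 2 / ε := by positivity
  rw [norm_sub_sq_real, norm_smul, Real.norm_of_nonneg hε.le, real_inner_smul_left] at h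
  have e : ((ε * ‖u‖) ^ 2 - 2 * (ε * ⟪u, v⟫) + ‖v‖ ^ 2) / ε
      = ε * ‖u‖ ^ 2 - 2 * ⟪u, v⟫ + 1 / ε * ‖v‖ ^ 2 := by
    field_simp
  rw [e] at h
  rw [norm_add_sq_real]
  linarith

theorem two_mul_mul_le_weighted (p q : ℝ) {ε : ℝ} (hε : 0 < ε) :
    2 * (p * q) ≤ ε * q ^ 2 + p ^ 2 / ε := by
  have h : 0 ≤ (ε * q - p) ^ 2 / ε := by positivity
  have e : (ε * q - p) ^ 2 / ε = ε * q ^ 2 - 2 * (p * q) + p ^ 2 / ε := by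
    field_simp
    ring
  linarith

theorem two_mul_inner_sub_sub_s7 (u v w : H) :
    2 * ⟪u - v, w - u⟫ = ‖v - w‖ ^ 2 - ‖u - v‖ ^ 2 - ‖u - w‖ ^ 2 := by
  have h : v - w = -((u - v) + (w - u)) := by abel
  rw [h, norm_neg, norm_add_sq_real, norm_sub_rev w u]
  ring

/-- Bound on the error made by replacing `F y` with the previous value `F y'`. -/
theorem two_mul_inner_le_of_norm_le {u x₁ x₀ y y' : H} {l α ε₁ ε₂ : ℝ} (hl : 0 < l) (hα : 0 ≤ α)
    (hε₁ : 0 < ε₁) (hε₂ : 0 < ε₂) (h : l * ‖u‖ ≤ α * ‖y - y'‖) :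
    2 * (l * ⟪u, y - x₁⟫) ≤ α * (ε₁ * ‖x₁ - y‖ ^ 2)
      + (1 + ε₂) / ε₁ * α * ‖x₀ - y'‖ ^ 2 + α / ε₁ * (1 + 1 / ε₂) * ‖x₀ - y‖ ^ 2 := by
  have h1 : l * ⟪u, y - x₁⟫ ≤ α * (‖y - y'‖ * ‖x₁ - y‖) :=
    calc l * ⟪u, y - x₁⟫ ≤ l * (‖u‖ * ‖y - x₁‖) :=
          mul_le_mul_of_nonneg_left (real_inner_le_norm _ _) hl.le
      _ = l * ‖u‖ * ‖x₁ - y‖ := by rw [norm_sub_rev y x₁]; ring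
      _ ≤ α * ‖y - y'‖ * ‖x₁ - y‖ := mul_le_mul_of_nonneg_right h (norm_nonneg _)
      _ = α * (‖y - y'‖ * ‖x₁ - y‖) := by ring
  have h2 := mul_le_mul_of_nonneg_left
    (two_mul_mul_le_weighted ‖y - y'‖ ‖x₁ - y‖ hε₁) hα
  have h3 : ‖y - y'‖ ^ 2 ≤ (1 + ε₂) * ‖x₀ - y'‖ ^ 2 + (1 + 1 / ε₂) * ‖x₀ - y‖ ^ 2 := by
    have := norm_add_sq_le_weighted (x₀ - y') (y - x₀) hε₂
    rwa [show x₀ - y' + (y - x₀) = y - y' by abel, norm_sub_rev y x₀] at this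
  have h4 := mul_le_mul_of_nonneg_left h3 (div_nonneg hα hε₁.le)
  have e1 : α * (‖y - y'‖ ^ 2 / ε₁) = α / ε₁ * ‖y - y'‖ ^ 2 := by ring
  have e2 : α / ε₁ * ((1 + ε₂) * ‖x₀ - y'‖ ^ 2 + (1 + 1 / ε₂) * ‖x₀ - y‖ ^ 2)
      = (1 + ε₂) / ε₁ * α * ‖x₀ - y'‖ ^ 2 + α / ε₁ * (1 + 1 / ε₂) * ‖x₀ - y‖ ^ 2 := by ring
  linarith

/-- The prox inequality at the previous iterate, tested at `x₂` and `x₀` and combined along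
`y = x₁ + δ (x₁ - x₀)`. -/
theorem inner_extrapolation_ge {g : H → ℝ} {x₂ x₁ x₀ y f : H} {δ l l' : ℝ} (hδ : 0 < δ)
    (hl : 0 < l) (hl' : 0 < l') (hy : y = x₁ + δ • (x₁ - x₀))
    (h : ∀ z : H, ⟪x₁ - x₀ + l' • f, z - x₁⟫ ≥ l' * (g x₁ - g z)) :
    l * ((1 + δ) * g x₁ - g x₂ - δ * g x₀) ≤
      l / (δ * l') * ⟪y - x₁, x₂ - y⟫ + l * ⟪f, x₂ - y⟫ := by
  have e1 : x₂ - y = (x₂ - x₁) + δ • (x₀ - x₁) := by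
    rw [hy]; module
  have e2 : ⟪x₁ - x₀ + l' • f, x₂ - y⟫
      = ⟪x₁ - x₀ + l' • f, x₂ - x₁⟫ + δ * ⟪x₁ - x₀ + l' • f, x₀ - x₁⟫ := by
    rw [e1, inner_add_right, real_inner_smul_right]
  have h1 : l' * ((1 + δ) * g x₁ - g x₂ - δ * g x₀) ≤ ⟪x₁ - x₀ + l' • f, x₂ - y⟫ := by
    have := mul_le_mul_of_nonneg_left (h x₀) hδ.le
    linarith [h x₂]
  have h2 := mul_le_mul_of_nonneg_left h1 (div_pos hl hl').le
  have e3 : y - x₁ = δ • (x₁ - x₀) := by rw [hy]; abel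
  rw [inner_add_left, real_inner_smul_left] at h2
  rw [e3, real_inner_smul_left]
  calc _ = l / l' * (l' * ((1 + δ) * g x₁ - g x₂ - δ * g x₀)) := by field_simp
    _ ≤ _ := h2
    _ = _ := by field_simp

/-- Monotonicity of `F` at an extrapolated point, in terms of the gap function `Phi`. -/
theorem inner_add_le_Phi {F : H → H} (g : H → ℝ)
    (hmono : ∀ u v : H, 0 ≤ ⟪F u - F v, u - v⟫) (xbar : H) {x₁ x₀ y : H} {δ : ℝ}
    (hy : y = x₁ + δ • (x₁ - x₀)) :
    ⟪F y, xbar - y⟫ + g xbar - (1 + δ) * g x₁ + δ * g x₀ ≤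
      δ * Phi F g xbar x₀ - (1 + δ) * Phi F g xbar x₁ := by
  have h := hmono y xbar
  have e1 : ⟪F y, xbar - y⟫ = -⟪F y, y - xbar⟫ := by
    rw [← inner_neg_right, neg_sub]
  have e2 : y - xbar = (1 + δ) • (x₁ - xbar) - δ • (x₀ - xbar) := by
    rw [hy]; module
  have e3 : ⟪F xbar, y - xbar⟫ = (1 + δ) * ⟪F xbar, x₁ - xbar⟫ - δ * ⟪F xbar, x₀ - xbar⟫ := by
    rw [e2, inner_sub_right, real_inner_smul_right, real_inner_smul_right]
  rw [inner_sub_left] at h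
  unfold Phi
  linarith

end InnerProductSpace

/-- descent inequality a(n+1) ≤ a(n) − b(n) (Lemma 5, version (12) of the paper). -/
theorem stmt7 {H : Type*} [NormedAddCommGroup H] [InnerProductSpace ℝ H]
    (g : H → ℝ) (hg : ConvexOn ℝ Set.univ g) (F : H → H)
    (hmono : ∀ u v : H, 0 ≤ ⟪F u - F v, u - v⟫)
    (δ α : ℝ) (hδ : 0 < δ) (hα : 0 ≤ α)
    (x y : ℕ → H) (lam : ℕ → ℝ)
    (hlampos : ∀ n : ℕ, 1 ≤ n → 0 < lam n)
    (hlam0 : 0 < lam 0)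
    (hlamdec : ∀ n : ℕ, 1 ≤ n → lam n ≤ lam (n - 1))
    (hy : ∀ n : ℕ, 1 ≤ n → y n = x n + δ • (x n - x (n - 1)))
    (hstep : ∀ n : ℕ, 1 ≤ n → ∀ z : H,
      ⟪x (n + 1) - x n + lam n • F (y n), z - x (n + 1)⟫ ≥ lam n * (g (x (n + 1)) - g z))
    (hlin : ∀ n : ℕ, 1 ≤ n → lam n * ‖F (y n) - F (y (n - 1))‖ ≤ α * ‖y n - y (n - 1)‖)
    (xbar : H) (hxbar : ∀ z : H, 0 ≤ Phi F g xbar z)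
    (ε₁ ε₂ : ℝ) (hε₁ : 0 < ε₁) (hε₂ : 0 < ε₂) :
    let a : ℕ → ℝ := fun n =>
      ‖x n - xbar‖ ^ 2 + 2 * lam (n - 1) * (1 + δ) * Phi F g xbar (x (n - 1))
        + ((1 + ε₂) / ε₁) * α * ‖x n - y (n - 1)‖ ^ 2
        + (1 - lam (n - 1) / (δ * lam (n - 2))) * ‖x n - x (n - 1)‖ ^ 2
    let b : ℕ → ℝ := fun n =>
      (lam n / (δ * lam (n - 1)) - (ε₁ + (1 + ε₂) / ε₁) * α) * ‖x (n + 1) - y n‖ ^ 2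
        + (lam n / (δ * lam (n - 1)) - (α / ε₁) * (1 + 1 / ε₂)
            + (1 / δ ^ 2) * (1 - lam (n - 1) / (δ * lam (n - 2)))) * ‖x n - y n‖ ^ 2
    ∀ n : ℕ, 2 ≤ n → a (n + 1) ≤ a n - b n := by
  intro a b n hn
  obtain ⟨k, rfl⟩ := Nat.exists_eq_add_of_le' hn
  have hl : 0 < lam (k + 2) := hlampos _ (by omega)
  have hl' : 0 < lam (k + 1) := hlampos _ (by omega)
  have hdec : lam (k + 2) ≤ lam (k + 1) := hlamdec (k + 2) (by omega)
  have hyn : y (k + 2) = x (k + 2) + δ • (x (k + 2) - x (k + 1)) := hy (k + 2) (by omega)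
  have hprox := hstep (k + 2) (by omega) xbar
  have hextra := inner_extrapolation_ge (x₂ := x (k + 3)) hδ hl hl' hyn
    (hstep (k + 1) (by omega))
  have hgap := mul_le_mul_of_nonneg_left (inner_add_le_Phi g hmono xbar hyn) hl.le
  have herr := two_mul_inner_le_of_norm_le (x₁ := x (k + 3)) (x₀ := x (k + 2)) hl hα hε₁ hε₂
    (hlin (k + 2) (by omega))
  have hPhi : lam (k + 2) * δ * Phi F g xbar (x (k + 1))
      ≤ lam (k + 1) * (1 + δ) * Phi F g xbar (x (k + 1)) :=
    mul_le_mul_of_nonneg_right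
      (mul_le_mul hdec (by linarith) hδ.le hl'.le) (hxbar _)
  have hdiff : ‖x (k + 2) - x (k + 1)‖ ^ 2 = 1 / δ ^ 2 * ‖x (k + 2) - y (k + 2)‖ ^ 2 := by
    rw [hyn, sub_add_cancel_left, norm_neg, norm_smul, Real.norm_of_nonneg hδ.le]
    field_simp
  have hpolar := two_mul_inner_sub_sub_s7 (x (k + 3)) (x (k + 2)) xbar
  have hpolar' := two_mul_inner_sub_sub_s7 (y (k + 2)) (x (k + 2)) (x (k + 3))
  rw [norm_sub_rev (x (k + 2)) (x (k + 3)), norm_sub_rev (y (k + 2)) (x (k + 2)),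
    norm_sub_rev (y (k + 2)) (x (k + 3))] at hpolar'
  have hinner : ⟪F (y (k + 2)), xbar - x (k + 3)⟫
      = ⟪F (y (k + 2)) - F (y (k + 1)), y (k + 2) - x (k + 3)⟫
        - ⟪F (y (k + 1)), x (k + 3) - y (k + 2)⟫ + ⟪F (y (k + 2)), xbar - y (k + 2)⟫ := by
    simp only [inner_sub_left, inner_sub_right]
    ring
  rw [show k + 2 + 1 = k + 3 from rfl, inner_add_left, real_inner_smul_left, hinner] at hprox
  simp only [a, b, show k + 2 + 1 = k + 3 from rfl, show k + 3 - 1 = k + 2 from rfl,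
    show k + 3 - 2 = k + 1 from rfl, show k + 2 - 1 = k + 1 from rfl,
    show k + 2 - 2 = k from rfl] at herr ⊢
  rw [hdiff]
  generalize lam (k + 2) / (δ * lam (k + 1)) = r at *
  have hr : r * (2 * ⟪y (k + 2) - x (k + 2), x (k + 3) - y (k + 2)⟫) = _ :=
    congrArg (r * ·) hpolar'
  linarith
end

section
/- Let H be a real Hilbert space, let F : H → H be monotone and L-Lipschitz (L > 0), let g : H → ℝ be convex and continuous, and assume the solution set S = {x* : ⟨F(x*), y−x*⟩ + g(y) − g(x*) ≥ 0 for all y ∈ H} is nonempty. Let δ ≥ 1, 0 < α < κ(δ), λ(0) > 0, x(0) = y(0) ∈ H, and let x(1) satisfy ⟨x(1) − x(0) + λ(0)F(x(0)), x − x(1)⟩ ≥ λ(0)(g(x(1)) − g(x)) for all x ∈ H. Suppose for every n ≥ 1: y(n) = x(n) + δ(x(n) − x(n−1)); λ(n) = min( λ(n−1), α‖y(n)−y(n−1)‖/‖F(y(n))−F(y(n−1))‖ ) if F(y(n)) ≠ F(y(n−1)) and λ(n) = λ(n−1) otherwise; and ⟨x(n+1) − x(n) + λ(n)F(y(n)),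 x − x(n+1)⟩ ≥ λ(n)(g(x(n+1)) − g(x)) for all x ∈ H. Then the sequence {x(n)} converges weakly to some point of S. -/
open scoped RealInnerProductSpace

open Filter Topology

section

variable {H : Type*} [NormedAddCommGroup H] [InnerProductSpace ℝ H]

/-- `p` solves the variational inequality iff `gap F g p v ≥ 0` for all `v`. -/
def gap (F : H → H) (g : H → ℝ) (p v : H) : ℝ := ⟪F p, v - p⟫ + g v - g p

/-- One-step energy estimate for the projected extrapolated gradient iteration. -/
lemma peg_descent {F : H → H} {g : H → ℝ} (hmono : ∀ u v : H, 0 ≤ ⟪F u - F v, u - v⟫)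
    {δ α θ ν μ : ℝ} (hδ : 1 ≤ δ) (hα : 0 ≤ α) (hθ0 : 0 ≤ θ) (hθ1 : θ ≤ 1) (hμ0 : 0 ≤ μ)
    (hμ : μ = θ * ν) {x₀ x₁ x₂ y₀ y₁ p : H}
    (hp : ∀ v, 0 ≤ gap F g p v)
    (hy₁ : y₁ = x₁ + δ • (x₁ - x₀))
    (hF : μ * ‖F y₁ - F y₀‖ ≤ α * ‖y₁ - y₀‖)
    (hprev : ∀ z, ⟪x₁ - x₀ + ν • F y₀, z - x₁⟫ ≥ ν * (g x₁ - g z))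
    (hcur : ∀ z, ⟪x₂ - x₁ + μ • F y₁, z - x₂⟫ ≥ μ * (g x₂ - g z)) (hνμ : μ ≤ ν) :
    ‖x₂ - p‖ ^ 2 + (1 - 1 / δ) * ‖x₂ - x₁‖ ^ 2 + α * ‖x₂ - y₁‖ ^ 2
        + 2 * (1 + δ) * (μ * gap F g p x₁)
      ≤ ‖x₁ - p‖ ^ 2 + α * ‖x₁ - y₀‖ ^ 2 + 2 * δ * (ν * gap F g p x₀)
        - θ * δ * ‖x₁ - x₀‖ ^ 2 - (θ / δ - 2 * α) * ‖x₂ - y₁‖ ^ 2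
        + 2 * α * δ * ‖x₁ - x₀‖ * ‖x₂ - y₁‖ := by
  have hδ0 : 0 < δ := by linarith
  have hCS : μ * ⟪F y₁ - F y₀, y₁ - x₂⟫
      ≤ α * (δ * ‖x₁ - x₀‖ + ‖x₁ - y₀‖) * ‖x₂ - y₁‖ := by
    have h1 := real_inner_le_norm (F y₁ - F y₀) (y₁ - x₂)
    have h2 : ‖y₁ - y₀‖ ≤ δ * ‖x₁ - x₀‖ + ‖x₁ - y₀‖ := by
      have : y₁ - y₀ = δ • (x₁ - x₀) + (x₁ - y₀) := by rw [hy₁]; abel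
      rw [this]
      refine (norm_add_le _ _).trans ?_
      rw [norm_smul, Real.norm_of_nonneg hδ0.le]
    rw [norm_sub_rev y₁ x₂] at h1
    calc _ ≤ μ * (‖F y₁ - F y₀‖ * ‖x₂ - y₁‖) := by gcongr
      _ = (μ * ‖F y₁ - F y₀‖) * ‖x₂ - y₁‖ := by ring
      _ ≤ (α * (δ * ‖x₁ - x₀‖ + ‖x₁ - y₀‖)) * ‖x₂ - y₁‖ := by
        exact mul_le_mul_of_nonneg_right (hF.trans (by gcongr)) (norm_nonneg _)
  have hprod : 2 * α * (‖x₁ - y₀‖ * ‖x₂ - y₁‖) ≤ α * (‖x₁ - y₀‖ ^ 2 + ‖x₂ - y₁‖ ^ 2) := by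
    nlinarith [sq_nonneg (‖x₁ - y₀‖ - ‖x₂ - y₁‖)]
  have hgap0 : 2 * δ * (μ * gap F g p x₀) ≤ 2 * δ * (ν * gap F g p x₀) := by
    gcongr; exact hp _
  have hm := mul_le_mul_of_nonneg_left (hmono y₁ p) hμ0
  have e1 := mul_le_mul_of_nonneg_left (hprev x₂) hθ0
  have e2 := mul_le_mul_of_nonneg_left (hprev x₀) (mul_nonneg hθ0 hδ0.le)
  have e3 := hcur p
  have key : ‖x₂ - p‖ ^ 2 + (1 - θ / δ) * ‖x₂ - x₁‖ ^ 2 + 2 * (1 + δ) * (μ * gap F g p x₁)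
      ≤ ‖x₁ - p‖ ^ 2 + 2 * δ * (μ * gap F g p x₀)
        - θ * δ * ‖x₁ - x₀‖ ^ 2 - (θ / δ) * ‖x₂ - y₁‖ ^ 2
        + 2 * (μ * ⟪F y₁ - F y₀, y₁ - x₂⟫) := by
    obtain ⟨a, rfl⟩ : ∃ a, x₀ = x₁ - a := ⟨x₁ - x₀, by abel⟩
    obtain ⟨b, rfl⟩ : ∃ b, x₂ = x₁ + b := ⟨x₂ - x₁, by abel⟩
    obtain ⟨c, rfl⟩ : ∃ c, x₁ = p + c := ⟨x₁ - p, by abel⟩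
    have hy : y₁ = p + c + δ • a := by rw [hy₁]; simp
    have i1 : p + c + b - p = c + b := by abel
    have i2 : p + c + b - (p + c) = b := by abel
    have i3 : p + c - p = c := by abel
    have i4 : p + c - a - p = c - a := by abel
    have i5 : p + c - (p + c - a) = a := by abel
    have i6 : p + c + b - y₁ = b - δ • a := by rw [hy]; abel
    have i7 : y₁ - (p + c + b) = δ • a - b := by rw [hy]; abel
    have i8 : y₁ - p = c + δ • a := by rw [hy]; abel
    have i9 : p + c - a - (p + c) = - a := by abel
    have i10 : p - (p + c + b) = - (c + b) := by abel
    generalize hu : F y₁ = u at *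
    generalize F y₀ = w at *
    simp only [gap, i1, i2, i3, i4, i5, i6, i7, i8, i9, i10, ge_iff_le,
      ← real_inner_self_eq_norm_sq, inner_add_left, inner_add_right, inner_sub_left,
      inner_sub_right, inner_neg_right, real_inner_smul_left, real_inner_smul_right]
      at hm e1 e2 e3 ⊢
    have s1 := real_inner_comm a b
    have s2 := real_inner_comm b c
    rw [s1, s2] at *
    obtain ⟨t, rfl⟩ : ∃ t, θ = t * δ := ⟨θ / δ, by field_simp⟩
    rw [mul_div_cancel_right₀ t hδ0.ne']
    subst hμ
    linarith
  have hlast : θ / δ * ‖x₂ - x₁‖ ^ 2 ≤ 1 / δ * ‖x₂ - x₁‖ ^ 2 := by gcongr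
  linarith

/-- Minty's lemma: a weak solution is a strong one. -/
lemma gap_minty {F : H → H} {g : H → ℝ} (hF : Continuous F) (hg : ConvexOn ℝ Set.univ g) {q : H}
    (h : ∀ z, gap F g z q ≤ 0) (w : H) : 0 ≤ gap F g q w := by
  have hlim : Tendsto (fun t : ℝ => ⟪F (q + t • (w - q)), w - q⟫ + g w - g q) (𝓝[>] 0)
      (𝓝 (gap F g q w)) := by
    have hc : Continuous (fun t : ℝ => ⟪F (q + t • (w - q)), w - q⟫ + g w - g q) := by
      fun_prop
    have := hc.tendsto 0
    simp only [zero_smul, add_zero] at this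
    exact this.mono_left nhdsWithin_le_nhds
  refine ge_of_tendsto hlim ?_
  filter_upwards [Ioo_mem_nhdsGT (zero_lt_one (α := ℝ))] with t ht
  have h1 := h (q + t • (w - q))
  have h2 := hg.2 (Set.mem_univ q) (Set.mem_univ w) (by linarith [ht.2] : 0 ≤ 1 - t) ht.1.le
    (by ring)
  have e : (1 - t) • q + t • w = q + t • (w - q) := by module
  rw [e] at h2
  simp only [gap, sub_add_cancel_left, inner_neg_right, real_inner_smul_right, smul_eq_mul] at h1 h2
  refine le_of_mul_le_mul_left ?_ ht.1
  linarith

lemma convex_gap_le {F : H → H} {g : H → ℝ} (hg : ConvexOn ℝ Set.univ g) (z : H) (c : ℝ) :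
    Convex ℝ {v | gap F g z v ≤ c} := by
  have h : ConvexOn ℝ Set.univ (gap F g z) := by
    refine ⟨convex_univ, fun u _ v _ a b ha hb hab => ?_⟩
    have h2 := hg.2 (Set.mem_univ u) (Set.mem_univ v) ha hb hab
    have e : a • u + b • v - z = a • (u - z) + b • (v - z) := by
      rw [smul_sub, smul_sub, sub_add_sub_comm, ← add_smul, hab, one_smul]
    simp only [gap, e, inner_add_right, real_inner_smul_right, smul_eq_mul] at h2 ⊢
    have : g z = a * g z + b * g z := by rw [← add_mul, hab, one_mul]
    linarith
  simpa using h.convex_le c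

lemma posDef_quadratic {A B C : ℝ} (hA : 0 < A) (hB : 0 < B) (hC : C ^ 2 < A * B) :
    ∃ m > 0, ∀ d e : ℝ, m * (d ^ 2 + e ^ 2) ≤ A * d ^ 2 - 2 * C * d * e + B * e ^ 2 := by
  have hAB : 0 < A + B := by positivity
  set m := (A * B - C ^ 2) / (A + B) with hm
  have hmm : m * (A + B) = A * B - C ^ 2 := by rw [hm]; field_simp
  refine ⟨m, div_pos (by linarith) hAB, fun d e => ?_⟩
  have hAm : 0 < A - m := by
    have : 0 < (A - m) * (A + B) := by nlinarith [sq_nonneg C]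
    exact pos_of_mul_pos_left this hAB.le
  have : 0 ≤ (A - m) * (A * d ^ 2 - 2 * C * d * e + B * e ^ 2 - m * (d ^ 2 + e ^ 2)) := by
    have e1 : (A - m) * (A * d ^ 2 - 2 * C * d * e + B * e ^ 2 - m * (d ^ 2 + e ^ 2))
      = ((A - m) * d - C * e) ^ 2 + m ^ 2 * e ^ 2 := by linear_combination (-e^2) * hmm
    rw [e1]; positivity
  have := nonneg_of_mul_nonneg_right this hAm
  linarith

lemma kappaFn_bounds {δ α : ℝ} (hδ : 1 ≤ δ) (hα : 0 < α) (h : α < kappaFn δ) :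
    0 < 1 / δ - 2 * α ∧ (α * δ) ^ 2 < (δ + 1 - 1 / δ) * (1 / δ - 2 * α) := by
  have hδ0 : 0 < δ := by linarith
  have hq : 0 < δ ^ 2 + δ - 1 := by nlinarith
  have ha : 0 < aFn δ := by unfold aFn; positivity
  have haq : aFn δ * (δ ^ 2 + δ - 1) = δ ^ 2 := div_mul_cancel₀ _ hq.ne'
  have hs2 : Real.sqrt (aFn δ + 1) ^ 2 = aFn δ + 1 := Real.sq_sqrt (by linarith)
  have hs1 : 1 < Real.sqrt (aFn δ + 1) := by
    rw [Real.lt_sqrt zero_le_one]; linarith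
  have hk : kappaFn δ = 1 / (δ * (Real.sqrt (aFn δ + 1) + 1)) := by
    unfold kappaFn
    nth_rw 2 [← hs2]
    field_simp
  rw [hk] at h
  generalize Real.sqrt (aFn δ + 1) = s at *
  generalize aFn δ = a at *
  have hβ : (α * δ) * (s + 1) < 1 := by
    rw [lt_div_iff₀ (by positivity)] at h; linarith
  have hβ0 : 0 < α * δ := by positivity
  have h1 : a * (α * δ) ^ 2 + 2 * (α * δ) < 1 := by
    have : a = (s - 1) * (s + 1) := by linarith
    have h3 : (s - 1) * (α * δ) * ((α * δ) * (s + 1)) ≤ (s - 1) * (α * δ) * 1 := by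
      have : 0 < s - 1 := by linarith
      gcongr
    rw [this]; linarith
  have eB : 1 / δ - 2 * α = (1 - 2 * (α * δ)) / δ := by field_simp
  have eA : δ + 1 - 1 / δ = (δ ^ 2 + δ - 1) / δ := by field_simp
  have hB : 0 < 1 - 2 * (α * δ) := by nlinarith [mul_pos ha (pow_pos hβ0 2)]
  refine ⟨eB ▸ div_pos hB hδ0, ?_⟩
  rw [eB, eA, div_mul_div_comm, lt_div_iff₀ (by positivity)]
  calc (α * δ) ^ 2 * (δ * δ) = (δ ^ 2 + δ - 1) * (a * (α * δ) ^ 2) := by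
        linear_combination (-(α * δ) ^ 2) * haq
    _ < (δ ^ 2 + δ - 1) * (1 - 2 * (α * δ)) := by gcongr; linarith

lemma exists_weak_limit [CompleteSpace H] {x : ℕ → H} {R : ℝ} (hx : ∀ n, ‖x n‖ ≤ R)
    (U : Ultrafilter ℕ) : ∃ q, ∀ v, Tendsto (fun n => ⟪x n, v⟫) U (𝓝 ⟪q, v⟫) := by
  let f : ℕ → WeakDual ℝ H := fun n => StrongDual.toWeakDual (InnerProductSpace.toDual ℝ H (x n))
  obtain ⟨φ, -, hφ⟩ := (WeakDual.isCompact_closedBall (𝕜 := ℝ) (E := H) 0 R).ultrafilter_le_nhds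
    (U.map f) (by
      simp only [Ultrafilter.coe_map, le_principal_iff, mem_map]
      refine Filter.univ_mem' fun n => ?_
      simpa [f] using hx n)
  refine ⟨(InnerProductSpace.toDual ℝ H).symm (WeakDual.toStrongDual φ), fun v => ?_⟩
  rw [InnerProductSpace.toDual_symm_apply]
  exact ((WeakDual.eval_continuous v).tendsto φ).comp hφ

lemma mem_of_weak_limit [CompleteSpace H] {l : Filter ℕ} [l.NeBot] {C : Set H} (hC : Convex ℝ C)
    (hCc : IsClosed C) {x : ℕ → H} {q : H} (hq : ∀ v, Tendsto (fun n => ⟪x n, v⟫) l (𝓝 ⟪q, v⟫))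
    (hx : ∀ᶠ n in l, x n ∈ C) : q ∈ C := by
  by_contra hqC
  obtain ⟨f, u, hfq, hf⟩ := geometric_hahn_banach_point_closed hC hCc hqC
  have hfe : ∀ v, f v = ⟪v, (InnerProductSpace.toDual ℝ H).symm f⟫ := fun v => by
    rw [real_inner_comm, InnerProductSpace.toDual_symm_apply]
  have := ge_of_tendsto (hq ((InnerProductSpace.toDual ℝ H).symm f))
    (hx.mono fun n hn => (hfe (x n) ▸ hf _ hn).le)
  rw [← hfe] at this
  linarith

/-- Opial's lemma. -/
lemma opial [CompleteSpace H] {S : Set H} {x : ℕ → H}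
    (hconv : ∀ p ∈ S, ∃ c, Tendsto (fun n => ‖x n - p‖ ^ 2) atTop (𝓝 c))
    (hclus : ∀ (U : Ultrafilter ℕ) (q : H), (U : Filter ℕ) ≤ atTop →
      (∀ v, Tendsto (fun n => ⟪x n, v⟫) U (𝓝 ⟪q, v⟫)) → q ∈ S) {R : ℝ} (hR : ∀ n, ‖x n‖ ≤ R) :
    ∃ p ∈ S, ∀ v : H, Tendsto (fun n => ⟪x n, v⟫) atTop (𝓝 ⟪p, v⟫) := by
  obtain ⟨U₀, hU₀⟩ := Ultrafilter.exists_le (atTop : Filter ℕ)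
  obtain ⟨p, hp⟩ := exists_weak_limit hR U₀
  have hpS := hclus U₀ p hU₀ hp
  refine ⟨p, hpS, fun v => (tendsto_iff_ultrafilter _ _ _).2 fun U hU => ?_⟩
  obtain ⟨q, hq⟩ := exists_weak_limit hR U
  have hqS := hclus U q hU hq
  obtain ⟨c, hc⟩ := hconv p hpS
  obtain ⟨d, hd⟩ := hconv q hqS
  have hdiff : Tendsto (fun n => ⟪x n, p - q⟫) atTop (𝓝 ((d - c + ‖p‖ ^ 2 - ‖q‖ ^ 2) / 2)) := by
    refine ((((hd.sub hc).add_const _).sub_const _).div_const 2).congr fun n => ?_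
    rw [norm_sub_sq_real, norm_sub_sq_real, inner_sub_right]
    ring
  have h1 := tendsto_nhds_unique (hp (p - q)) (hdiff.mono_left hU₀)
  have h2 := tendsto_nhds_unique (hq (p - q)) (hdiff.mono_left hU)
  have h3 : ⟪p - q, p - q⟫ = 0 := by rw [inner_sub_left, h1, h2, sub_self]
  have hpq : p = q := sub_eq_zero.1 (inner_self_eq_zero.1 h3)
  subst hpq
  exact hq v

lemma tendsto_of_eventually_descent {V r : ℕ → ℝ} (hV : ∀ n, 0 ≤ V n) (hr : ∀ n, 0 ≤ r n)
    (h : ∀ᶠ n in atTop, V (n + 1) + r n ≤ V n) :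
    (∃ c, Tendsto V atTop (𝓝 c)) ∧ Tendsto r atTop (𝓝 0) := by
  obtain ⟨N, hN⟩ := eventually_atTop.1 h
  have hanti : Antitone fun n => V (n + N) := antitone_nat_of_succ_le fun n => by
    have := hN (n + N) (by omega)
    have := hr (n + N)
    rw [show n + 1 + N = n + N + 1 by ring]
    linarith
  have hc := (tendsto_add_atTop_iff_nat N).1
    (tendsto_atTop_ciInf hanti ⟨0, by rintro _ ⟨n, rfl⟩; exact hV _⟩)
  refine ⟨⟨_, hc⟩, ?_⟩
  have h0 := hc.sub (hc.comp (tendsto_add_atTop_nat 1))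
  rw [sub_self] at h0
  refine squeeze_zero' (Eventually.of_forall hr) (h.mono fun n hn => ?_) h0
  simp only [Function.comp]
  linarith

lemma gap_le_of_step {F : H → H} {g : H → ℝ} {L m μ R : ℝ}
    (hmono : ∀ u v : H, 0 ≤ ⟪F u - F v, u - v⟫) (hL : 0 ≤ L)
    (hlip : ∀ u v : H, ‖F u - F v‖ ≤ L * ‖u - v‖) (hm : 0 < m) (hμ : m ≤ μ) {x₀ x₁ y z : H}
    (hR : ‖x₁ - z‖ ≤ R)
    (hstep : ⟪x₁ - x₀ + μ • F y, z - x₁⟫ ≥ μ * (g x₁ - g z)) :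
    gap F g z x₁ ≤ ‖x₁ - x₀‖ * R / m + L * (‖x₁ - y‖ + R) * ‖x₁ - y‖ := by
  have hμ0 : 0 < μ := by linarith
  have hR0 : 0 ≤ R := (norm_nonneg _).trans hR
  have h1 : ⟪x₁ - x₀, z - x₁⟫ ≤ ‖x₁ - x₀‖ * R :=
    (real_inner_le_norm _ _).trans (by rw [norm_sub_rev z]; gcongr)
  have h2 : ⟪F y - F z, y - x₁⟫ ≤ L * (‖x₁ - y‖ + R) * ‖x₁ - y‖ := by
    refine (real_inner_le_norm _ _).trans ?_
    rw [norm_sub_rev y]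
    have : ‖y - z‖ ≤ ‖x₁ - y‖ + R := by
      rw [← sub_add_sub_cancel y x₁ z]
      exact (norm_add_le _ _).trans (by rw [norm_sub_rev y]; gcongr)
    exact mul_le_mul_of_nonneg_right ((hlip y z).trans (by gcongr)) (norm_nonneg _)
  have h3 := hmono y z
  have h4 : ⟪F y, z - x₁⟫ ≤ ⟪F z, z - x₁⟫ + ⟪F y - F z, y - x₁⟫ := by
    simp only [inner_sub_left, inner_sub_right] at h3 ⊢
    linarith
  have h5 : μ * gap F g z x₁ ≤ ‖x₁ - x₀‖ * R + μ * (L * (‖x₁ - y‖ + R) * ‖x₁ - y‖) := by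
    have h6 := mul_le_mul_of_nonneg_left (h4.trans (add_le_add_right h2 _)) hμ0.le
    rw [inner_add_left, real_inner_smul_left] at hstep
    have h7 : ⟪F z, z - x₁⟫ = -⟪F z, x₁ - z⟫ := by rw [← inner_neg_right, neg_sub]
    rw [h7] at h6
    unfold gap
    linarith
  have h8 : ‖x₁ - x₀‖ * R ≤ μ * (‖x₁ - x₀‖ * R / m) := by
    have : ‖x₁ - x₀‖ * R = m * (‖x₁ - x₀‖ * R / m) := by field_simp
    calc _ = m * (‖x₁ - x₀‖ * R / m) := this
      _ ≤ _ := by gcongr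
  refine le_of_mul_le_mul_left ?_ hμ0
  linarith

lemma step_sizes {E G : Type*} [NormedAddCommGroup E] [NormedAddCommGroup G] {F : E → G}
    {L α : ℝ} (hL : 0 < L)
    (hlip : ∀ u v, ‖F u - F v‖ ≤ L * ‖u - v‖) (hα0 : 0 < α) {y : ℕ → E} {lam : ℕ → ℝ}
    (hlam : ∀ n : ℕ, 1 ≤ n →
      (F (y n) ≠ F (y (n - 1)) →
        lam n = min (lam (n - 1)) (α * ‖y n - y (n - 1)‖ / ‖F (y n) - F (y (n - 1))‖)) ∧
      (F (y n) = F (y (n - 1)) → lam n = lam (n - 1))) :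
    (∀ n, min (lam 0) (α / L) ≤ lam n) ∧ (∀ n, lam (n + 1) ≤ lam n) ∧
      ∀ n, lam (n + 1) * ‖F (y (n + 1)) - F (y n)‖ ≤ α * ‖y (n + 1) - y n‖ := by
  have hs : ∀ n, min (lam n) (α / L) ≤ lam (n + 1) ∧ lam (n + 1) ≤ lam n ∧
      lam (n + 1) * ‖F (y (n + 1)) - F (y n)‖ ≤ α * ‖y (n + 1) - y n‖ := by
    intro n
    obtain ⟨h1, h2⟩ := hlam (n + 1) (by omega)
    simp only [add_tsub_cancel_right] at h1 h2
    by_cases he : F (y (n + 1)) = F (y n)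
    · rw [h2 he, he, sub_self, norm_zero, mul_zero]
      exact ⟨min_le_left _ _, le_rfl, by positivity⟩
    · have hpos : 0 < ‖F (y (n + 1)) - F (y n)‖ := norm_pos_iff.2 (sub_ne_zero.2 he)
      rw [h1 he]
      refine ⟨min_le_min_left _ ?_, min_le_left _ _, ?_⟩
      · rw [div_le_div_iff₀ hL hpos]
        have := mul_le_mul_of_nonneg_left (hlip (y (n + 1)) (y n)) hα0.le
        linarith
      · exact (le_div_iff₀ hpos).1 (min_le_right _ _)
  refine ⟨fun n => ?_, fun n => (hs n).2.1, fun n => (hs n).2.2⟩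
  induction n with
  | zero => exact min_le_left _ _
  | succ n ih => exact (le_min ih (min_le_right _ _)).trans (hs n).1

end

/-- weak convergence of Algorithm 1 (PEG) for δ ≥ 1 (Theorem 1 of the paper). -/
theorem stmt9 {H : Type*} [NormedAddCommGroup H] [InnerProductSpace ℝ H] [CompleteSpace H]
    (F : H → H) (L : ℝ) (hL : 0 < L)
    (hmono : ∀ u v : H, 0 ≤ ⟪F u - F v, u - v⟫)
    (hlip : ∀ u v : H, ‖F u - F v‖ ≤ L * ‖u - v‖)
    (g : H → ℝ) (hgconv : ConvexOn ℝ Set.univ g) (hgcont : Continuous g)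
    (S : Set H) (hS : S = {xs : H | ∀ y : H, 0 ≤ ⟪F xs, y - xs⟫ + g y - g xs})
    (hSne : S.Nonempty)
    (δ α : ℝ) (hδ : 1 ≤ δ) (hα0 : 0 < α) (hακ : α < kappaFn δ)
    (x y : ℕ → H) (lam : ℕ → ℝ) (hlam0 : 0 < lam 0)
    (hy0 : y 0 = x 0)
    (hx1 : ∀ z : H, ⟪x 1 - x 0 + lam 0 • F (x 0), z - x 1⟫ ≥ lam 0 * (g (x 1) - g z))
    (hy : ∀ n : ℕ, 1 ≤ n → y n = x n + δ • (x n - x (n - 1)))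
    (hlam : ∀ n : ℕ, 1 ≤ n →
      (F (y n) ≠ F (y (n - 1)) →
        lam n = min (lam (n - 1)) (α * ‖y n - y (n - 1)‖ / ‖F (y n) - F (y (n - 1))‖)) ∧
      (F (y n) = F (y (n - 1)) → lam n = lam (n - 1)))
    (hstep : ∀ n : ℕ, 1 ≤ n → ∀ z : H,
      ⟪x (n + 1) - x n + lam n • F (y n), z - x (n + 1)⟫ ≥ lam n * (g (x (n + 1)) - g z)) :
    ∃ p ∈ S, ∀ v : H,
      Filter.Tendsto (fun n => ⟪x n, v⟫) Filter.atTop (nhds ⟪p, v⟫) := by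
  have hδ0 : 0 < δ := by linarith
  obtain ⟨hB, hC⟩ := kappaFn_bounds hδ hα0 hακ
  have hδi : 1 / δ ≤ 1 := by rw [div_le_one hδ0]; exact hδ
  obtain ⟨m, hm, hquad⟩ := posDef_quadratic (by linarith : 0 < δ + 1 - 1 / δ) hB hC
  obtain ⟨hlow, hmon, hFstep⟩ := step_sizes hL hlip hα0 hlam
  set ρ := min (lam 0) (α / L) with hρ
  have hρ0 : 0 < ρ := lt_min hlam0 (by positivity)
  have hlp : ∀ n, 0 < lam n := fun n => hρ0.trans_le (hlow n)
  have hstep' : ∀ n z, ⟪x (n + 1) - x n + lam n • F (y n), z - x (n + 1)⟫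
      ≥ lam n * (g (x (n + 1)) - g z) := by
    intro n z
    rcases n with _ | n
    · rw [hy0]; exact hx1 z
    · exact hstep _ (by omega) z
  have hratio : ∀ᶠ n in atTop, 1 - m / (2 * δ) ≤ lam (n + 1) / lam n := by
    have hanti : Antitone lam := antitone_nat_of_succ_le hmon
    have hl := tendsto_atTop_ciInf hanti ⟨ρ, by rintro _ ⟨n, rfl⟩; exact hlow n⟩
    have hl0 : (⨅ i, lam i) ≠ 0 := (hρ0.trans_le (le_ciInf hlow)).ne'
    have h1 := (hl.comp (tendsto_add_atTop_nat 1)).div hl hl0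
    rw [div_self hl0] at h1
    refine (h1.eventually (lt_mem_nhds (sub_lt_self 1 (by positivity : 0 < m / (2 * δ))))).mono
      fun n hn => hn.le
  have hdesc : ∀ p ∈ S, (∃ c, Tendsto (fun n => ‖x n - p‖ ^ 2) atTop (𝓝 c)) ∧
      Tendsto (fun n => ‖x (n + 1) - x n‖ ^ 2) atTop (𝓝 0) ∧
      Tendsto (fun n => ‖x (n + 1) - y n‖ ^ 2) atTop (𝓝 0) := by
    intro p hpS
    have hp : ∀ v, 0 ≤ gap F g p v := by
      rw [hS] at hpS
      simpa only [gap, Set.mem_ofPred_eq] using hpS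
    let W : ℕ → ℝ := fun n => (1 - 1 / δ) * ‖x (n + 1) - x n‖ ^ 2
      + α * ‖x (n + 1) - y n‖ ^ 2 + 2 * δ * (lam n * gap F g p (x n))
    let r : ℕ → ℝ := fun n => 2 * (lam (n + 1) * gap F g p (x (n + 1)))
      + m / 2 * (‖x (n + 1) - x n‖ ^ 2 + ‖x (n + 1 + 1) - y (n + 1)‖ ^ 2)
    have hgap : ∀ n, 0 ≤ lam n * gap F g p (x n) := fun n => mul_nonneg (hlp n).le (hp _)
    have hW : ∀ n, 0 ≤ W n := fun n => by
      have := hgap n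
      have : 0 ≤ 1 - 1 / δ := by linarith
      positivity
    have hr : ∀ n, 0 ≤ r n := fun n => by
      have := hgap (n + 1)
      positivity
    obtain ⟨⟨c, hc⟩, hr0⟩ := tendsto_of_eventually_descent
      (V := fun n => ‖x (n + 1) - p‖ ^ 2 + W n) (r := r)
      (fun n => add_nonneg (sq_nonneg _) (hW n)) hr (by
        filter_upwards [hratio] with n hn
        have hθ1 : lam (n + 1) / lam n ≤ 1 := (div_le_one (hlp n)).2 (hmon n)
        have h1 := peg_descent hmono hδ hα0.le (div_nonneg (hlp (n + 1)).le (hlp n).le)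
          hθ1 (hlp (n + 1)).le (div_mul_cancel₀ _ (hlp n).ne').symm hp
          (by simpa using hy (n + 1) (by omega)) (hFstep n) (hstep' n) (hstep' (n + 1)) (hmon n)
        have h2 := hquad ‖x (n + 1) - x n‖ ‖x (n + 1 + 1) - y (n + 1)‖
        generalize lam (n + 1) / lam n = θ at *
        have h3 : (1 - θ) * δ ≤ m / 2 := by
          have : 1 - θ ≤ m / (2 * δ) := by linarith
          calc (1 - θ) * δ ≤ m / (2 * δ) * δ := by gcongr
            _ = m / 2 := by field_simp
        have h4 : (1 - θ) * (1 / δ) ≤ m / 2 := by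
          refine le_trans ?_ h3
          have : 0 ≤ 1 - θ := by linarith
          gcongr
          linarith
        have h5 := mul_le_mul_of_nonneg_right h3 (sq_nonneg ‖x (n + 1) - x n‖)
        have h6 := mul_le_mul_of_nonneg_right h4 (sq_nonneg ‖x (n + 1 + 1) - y (n + 1)‖)
        rw [div_eq_mul_one_div θ δ] at h1
        simp only [W, r]
        linarith)
    have hd : Tendsto (fun n => ‖x (n + 1) - x n‖ ^ 2) atTop (𝓝 0) := by
      refine squeeze_zero (fun n => sq_nonneg _) (fun n => ?_)
        (by simpa using hr0.const_mul (2 / m))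
      have := hgap (n + 1)
      have h : ‖x (n + 1) - x n‖ ^ 2 = 2 / m * (m / 2 * ‖x (n + 1) - x n‖ ^ 2) := by field_simp
      rw [h]
      gcongr
      simp only [r]
      nlinarith [mul_nonneg hm.le (sq_nonneg ‖x (n + 1 + 1) - y (n + 1)‖)]
    have he : Tendsto (fun n => ‖x (n + 1) - y n‖ ^ 2) atTop (𝓝 0) := by
      refine (tendsto_add_atTop_iff_nat 1).1 (squeeze_zero (fun n => sq_nonneg _) (fun n => ?_)
        (by simpa using hr0.const_mul (2 / m)))
      have := hgap (n + 1)
      have h : ‖x (n + 1 + 1) - y (n + 1)‖ ^ 2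
          = 2 / m * (m / 2 * ‖x (n + 1 + 1) - y (n + 1)‖ ^ 2) := by field_simp
      rw [h]
      gcongr
      simp only [r]
      nlinarith [mul_nonneg hm.le (sq_nonneg ‖x (n + 1) - x n‖)]
    have hg0 : Tendsto (fun n => lam n * gap F g p (x n)) atTop (𝓝 0) := by
      refine (tendsto_add_atTop_iff_nat 1).1 (squeeze_zero (fun n => hgap _) (fun n => ?_) hr0)
      have := hgap (n + 1)
      have : 0 ≤ m / 2 * (‖x (n + 1) - x n‖ ^ 2 + ‖x (n + 1 + 1) - y (n + 1)‖ ^ 2) := by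
        positivity
      simp only [r]
      linarith
    refine ⟨⟨c, (tendsto_add_atTop_iff_nat 1).1 ?_⟩, hd, he⟩
    have hW0 : Tendsto W atTop (𝓝 0) := by
      simpa [W] using ((hd.const_mul (1 - 1 / δ)).add (he.const_mul α)).add (hg0.const_mul (2 * δ))
    simpa using hc.sub hW0
  obtain ⟨p₀, hp₀⟩ := hSne
  obtain ⟨⟨c₀, hc₀⟩, hd2, he2⟩ := hdesc p₀ hp₀
  have hd : Tendsto (fun n => ‖x (n + 1) - x n‖) atTop (𝓝 0) := by
    simpa [Real.sqrt_sq] using hd2.sqrt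
  have he : Tendsto (fun n => ‖x (n + 1) - y n‖) atTop (𝓝 0) := by
    simpa [Real.sqrt_sq] using he2.sqrt
  obtain ⟨R, hR⟩ : ∃ R, ∀ n, ‖x n‖ ≤ R := by
    obtain ⟨M, hM⟩ := hc₀.bddAbove_range
    refine ⟨Real.sqrt M + ‖p₀‖, fun n => ?_⟩
    have h1 : ‖x n - p₀‖ ≤ Real.sqrt M := Real.le_sqrt_of_sq_le (hM ⟨n, rfl⟩)
    have h2 := norm_le_norm_add_norm_sub' (x n) p₀
    linarith
  have hFc : Continuous F := (LipschitzWith.of_dist_le_mul (K := ⟨L, hL.le⟩) fun u v => by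
    rw [dist_eq_norm, dist_eq_norm]; exact hlip u v).continuous
  have hgap_small : ∀ z, ∀ ε > 0, ∀ᶠ n in atTop, gap F g z (x n) ≤ ε := by
    intro z ε hε
    have hlim : Tendsto (fun n => ‖x (n + 1) - x n‖ * (R + ‖z‖) / ρ
        + L * (‖x (n + 1) - y n‖ + (R + ‖z‖)) * ‖x (n + 1) - y n‖) atTop (𝓝 0) := by
      simpa using ((hd.mul_const (R + ‖z‖)).div_const ρ).add
        (((he.add_const (R + ‖z‖)).const_mul L).mul he)
    have h : ∀ᶠ n in atTop, gap F g z (x (n + 1)) ≤ ε := by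
      filter_upwards [hlim.eventually (gt_mem_nhds hε)] with n hn
      refine (gap_le_of_step hmono hL.le hlip hρ0 (hlow n) ?_ (hstep' n z)).trans hn.le
      exact (norm_sub_le _ _).trans (by gcongr; exact hR _)
    rw [← map_add_atTop_eq_nat 1]
    exact h
  refine opial (fun p hp => (hdesc p hp).1) (fun U q hU hq => ?_) hR
  rw [hS]
  refine fun w => gap_minty hFc hgconv (fun z => le_of_forall_pos_le_add fun ε hε => ?_) w
  rw [zero_add]
  have hcl : IsClosed {v | gap F g z v ≤ ε} :=
    isClosed_le (by unfold gap; fun_prop) continuous_const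
  exact mem_of_weak_limit (convex_gap_le hgconv z ε) hcl hq (hU (hgap_small z ε hε))
end

section
/- Let H be a real Hilbert space, let F : H → H be monotone and L-Lipschitz (L > 0), let g : H → ℝ be convex and continuous, and assume the solution set S = {x* : ⟨F(x*), y−x*⟩ + g(y) − g(x*) ≥ 0 for all y ∈ H} is nonempty. Let (√5−1)/2 < δ < 1 and 0 < α < κ(δ). Let x : ℕ → H, y : ℕ → H, λ : ℕ → ℝ satisfy, for all n ≥ 1: y(n) = x(n) + δ(x(n) − x(n−1)); 0 < λ(n) ≤ λ(n−1); λ(n)‖F(y(n)) − F(y(n−1))‖ ≤ α‖y(n) − y(n−1)‖; ⟨x(n+1) − x(n) + λ(n)F(y(n)), x − x(n+1)⟩ ≥ λ(n)(g(x(n+1)) − g(x)) for all x ∈ H. Assume moreover inf_n λ(n) > 0 and sup_n ‖x(n+1) − x(n)‖ < ∞. Then the sequence {x(n)} converges weakly to some point of S. -/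
open scoped RealInnerProductSpace

open Filter Topology

section Parameters

/-- The bound `α < κ(δ)` leaves a definite gap in the quadratic form controlling the descent. -/
lemma exists_gap_of_lt_kappaFn {δ α : ℝ} (hδ : (Real.sqrt 5 - 1) / 2 < δ) (hα0 : 0 < α)
    (hακ : α < kappaFn δ) :
    ∃ c, 0 < c ∧ c < δ + 1 - 1 / δ ∧
      (α * δ) ^ 2 ≤ (δ + 1 - 1 / δ - c) * (1 / δ - 2 * α - c) := by
  have h5 : Real.sqrt 5 ^ 2 = 5 := Real.sq_sqrt (by norm_num)
  have h52 : 2 < Real.sqrt 5 := Real.lt_sqrt_of_sq_lt (by norm_num)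
  have hδ0 : 0 < δ := by linarith
  have hq : 0 < δ ^ 2 + δ - 1 := by nlinarith
  have ha : 0 < aFn δ := by unfold aFn; positivity
  have hb : δ + 1 - 1 / δ = δ / aFn δ := by unfold aFn; field_simp
  set a := aFn δ with ha_def
  have hs0 : 1 < Real.sqrt (a + 1) := Real.lt_sqrt_of_sq_lt (by linarith)
  have hs2 : Real.sqrt (a + 1) ^ 2 = a + 1 := Real.sq_sqrt (by linarith)
  have hκ : kappaFn δ = 1 / (δ * (1 + Real.sqrt (a + 1))) := by
    unfold kappaFn
    rw [← ha_def]
    set s := Real.sqrt (a + 1)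
    have h1 : a + 1 + s = s * (1 + s) := by linarith
    rw [h1]
    field_simp
  set s := Real.sqrt (a + 1)
  have ht : α * δ * (1 + s) < 1 := by
    rw [hκ, lt_div_iff₀ (by positivity)] at hακ
    linarith
  set t := α * δ with t_def
  have ht0 : 0 < t := by positivity
  have hquad : a * t ^ 2 + 2 * t < 1 := by
    have h1 : a = (s - 1) * (s + 1) := by linarith
    have h2 : (t * (1 + s)) * ((s - 1) * t) < 1 * ((s - 1) * t) :=
      mul_lt_mul_of_pos_right ht (mul_pos (by linarith) ht0)
    rw [h1]
    nlinarith
  have hK : 1 / δ - 2 * α = (1 - 2 * t) / δ := by rw [t_def]; field_simp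
  have hb0 : 0 < δ / a := by positivity
  have hK0 : 0 < (1 - 2 * t) / δ := div_pos (by nlinarith [sq_nonneg t]) hδ0
  have hbK : t ^ 2 < δ / a * ((1 - 2 * t) / δ) := by
    have h1 : δ / a * ((1 - 2 * t) / δ) = (1 - 2 * t) / a := by field_simp
    rw [h1, lt_div_iff₀ ha]
    linarith
  rw [hb, hK]
  set b := δ / a
  set K := (1 - 2 * t) / δ
  have hsum : 0 < b + K := by positivity
  have hc : (b * K - t ^ 2) / (b + K) * (b + K) = b * K - t ^ 2 := by field_simp
  refine ⟨(b * K - t ^ 2) / (b + K), div_pos (by linarith) hsum, ?_, ?_⟩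
  · rw [div_lt_iff₀ hsum]
    nlinarith
  · nlinarith [sq_nonneg ((b * K - t ^ 2) / (b + K))]

lemma two_mul_mul_le_of_sq_le {p q t D e : ℝ} (hp : 0 < p) (h : t ^ 2 ≤ p * q) :
    2 * (t * D * e) ≤ p * D ^ 2 + q * e ^ 2 := by
  have h1 : 0 ≤ p * (p * D ^ 2 + q * e ^ 2 - 2 * (t * D * e)) := by
    nlinarith [sq_nonneg (p * D - t * e), mul_le_mul_of_nonneg_right h (sq_nonneg e)]
  linarith [nonneg_of_mul_nonneg_right h1 hp]

end Parameters

lemma tendsto_of_add_le {V u : ℕ → ℝ} {B : ℝ} (hV : ∀ n, B ≤ V n) (hu : ∀ n, 0 ≤ u n)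
    (h : ∀ n, V (n + 1) + u n ≤ V n) :
    (∃ l, Tendsto V atTop (𝓝 l)) ∧ Tendsto u atTop (𝓝 0) := by
  have hanti : Antitone V := antitone_nat_of_succ_le fun n => by linarith [h n, hu n]
  have hlim : Tendsto V atTop (𝓝 (⨅ n, V n)) :=
    tendsto_atTop_ciInf hanti ⟨B, by rintro _ ⟨n, rfl⟩; exact hV n⟩
  refine ⟨⟨_, hlim⟩, ?_⟩
  have hdiff := hlim.sub (hlim.comp (tendsto_add_atTop_nat 1))
  rw [sub_self] at hdiff
  exact squeeze_zero hu (fun n => by have := h n; simp only [Function.comp_apply]; linarith) hdiff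

lemma tendsto_zero_of_const_mul_le {u v : ℕ → ℝ} {c : ℝ} (hc : 0 < c) (hv : ∀ n, 0 ≤ v n)
    (h : ∀ n, c * v n ≤ u n) (hu : Tendsto u atTop (𝓝 0)) : Tendsto v atTop (𝓝 0) :=
  squeeze_zero hv (fun n => (le_div_iff₀' hc).2 (h n)) (by simpa using hu.div_const c)

section Hilbert

variable {H : Type*} [NormedAddCommGroup H] [InnerProductSpace ℝ H]

/-- One step of the extrapolated proximal method, in terms of increments: `d₁`, `d₂` are two
consecutive increments, `w` is the current error, `f₀`, `f₁` are the two operator values. -/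
lemma norm_sq_le_of_extrapolated_step {w d₁ d₂ f₀ f₁ fs : H} {δ l₀ l₁ g₀ g₁ g₂ gs R : ℝ}
    (hδ : 0 ≤ δ) (hl₀ : 0 < l₀) (hl₁ : 0 ≤ l₁)
    (h₁ : ⟪d₂ + l₁ • f₁, -(w + d₂)⟫ ≥ l₁ * (g₂ - gs))
    (h₂ : ⟪d₁ + l₀ • f₀, d₂⟫ ≥ l₀ * (g₁ - g₂))
    (h₃ : ⟪d₁ + l₀ • f₀, -d₁⟫ ≥ l₀ * (g₁ - g₀))
    (h₄ : 0 ≤ ⟪f₁ - fs, w + δ • d₁⟫)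
    (h₅ : -R ≤ l₁ * ⟪f₁ - f₀, d₂ - δ • d₁⟫) :
    ‖w + d₂‖ ^ 2 ≤ ‖w‖ ^ 2 - ‖d₂‖ ^ 2 + 2 * (l₁ / l₀) * (⟪d₁, d₂⟫ - δ * ‖d₁‖ ^ 2) + 2 * R
      - 2 * l₁ * ((1 + δ) * (⟪fs, w⟫ + g₁ - gs) - δ * (⟪fs, w - d₁⟫ + g₀ - gs)) := by
  have hr : l₁ / l₀ * l₀ = l₁ := by field_simp
  have hr0 : 0 ≤ l₁ / l₀ := by positivity
  have h₂' := mul_le_mul_of_nonneg_left h₂ hr0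
  have h₃' := mul_le_mul_of_nonneg_left h₃ (mul_nonneg hr0 hδ)
  have h₄' := mul_nonneg hl₁ h₄
  generalize l₁ / l₀ = r at *
  subst hr
  rw [norm_add_sq_real]
  simp only [← real_inner_self_eq_norm_sq, inner_add_left, inner_add_right, inner_sub_left,
    inner_sub_right, inner_neg_right, inner_smul_left, inner_smul_right,
    RCLike.conj_to_real] at *
  rw [real_inner_comm w d₂] at *
  nlinarith

/-- Descent of the Lyapunov function along one step, up to the variation `l₀ - l₁` of the
step sizes. -/
lemma lyapunov_descent {w d₁ d₂ q f₀ f₁ fs : H} {δ α c τ M l₀ l₁ g₀ g₁ g₂ gs : ℝ}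
    (hδ : 0 < δ) (hδ1 : δ ≤ 1) (hα : 0 ≤ α) (hcb : c < δ + 1 - 1 / δ)
    (hgap : (α * δ) ^ 2 ≤ (δ + 1 - 1 / δ - c) * (1 / δ - 2 * α - c))
    (hτ : 0 < τ) (hτl : τ ≤ l₁) (hl : l₁ ≤ l₀) (hd₁ : ‖d₁‖ ≤ M) (hd₂ : ‖d₂‖ ≤ M)
    (h₁ : ⟪d₂ + l₁ • f₁, -(w + d₂)⟫ ≥ l₁ * (g₂ - gs))
    (h₂ : ⟪d₁ + l₀ • f₀, d₂⟫ ≥ l₀ * (g₁ - g₂))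
    (h₃ : ⟪d₁ + l₀ • f₀, -d₁⟫ ≥ l₀ * (g₁ - g₀))
    (h₄ : 0 ≤ ⟪f₁ - fs, w + δ • d₁⟫)
    (h₅ : l₁ * ‖f₁ - f₀‖ ≤ α * ‖δ • d₁ + q‖)
    (hΘ : 0 ≤ ⟪fs, w - d₁⟫ + g₀ - gs) :
    (‖w + d₂‖ ^ 2 - (1 / δ - 1) * ‖d₂‖ ^ 2 + α * ‖d₂ - δ • d₁‖ ^ 2
        + 2 * l₁ * (1 + δ) * (⟪fs, w⟫ + g₁ - gs) + 4 * M ^ 2 / τ * l₁)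
      + (c * ‖d₁‖ ^ 2 + c * ‖d₂ - δ • d₁‖ ^ 2 + 2 * τ * (⟪fs, w - d₁⟫ + g₀ - gs))
      ≤ ‖w‖ ^ 2 - (1 / δ - 1) * ‖d₁‖ ^ 2 + α * ‖q‖ ^ 2
        + 2 * l₀ * (1 + δ) * (⟪fs, w - d₁⟫ + g₀ - gs) + 4 * M ^ 2 / τ * l₀ := by
  have hl₁ : 0 < l₁ := hτ.trans_le hτl
  have hl₀ : 0 < l₀ := hl₁.trans_le hl
  have hR : -(α * (δ * ‖d₁‖ + ‖q‖) * ‖d₂ - δ • d₁‖) ≤ l₁ * ⟪f₁ - f₀, d₂ - δ • d₁⟫ := by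
    have hcs := neg_le_of_abs_le (abs_real_inner_le_norm (f₁ - f₀) (d₂ - δ • d₁))
    have htri : ‖δ • d₁ + q‖ ≤ δ * ‖d₁‖ + ‖q‖ := by
      simpa [norm_smul, abs_of_pos hδ] using norm_add_le (δ • d₁) q
    have hfac := mul_le_mul_of_nonneg_right (h₅.trans (mul_le_mul_of_nonneg_left htri hα))
      (norm_nonneg (d₂ - δ • d₁))
    nlinarith [mul_le_mul_of_nonneg_left hcs hl₁.le]
  have hstep := norm_sq_le_of_extrapolated_step hδ.le hl₀ hl₁.le h₁ h₂ h₃ h₄ hR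
  have hM : 0 ≤ M := (norm_nonneg _).trans hd₁
  have hX : -(2 * M ^ 2) ≤ ⟪d₁, d₂⟫ - δ * ‖d₁‖ ^ 2 := by
    have hcs := neg_le_of_abs_le (abs_real_inner_le_norm d₁ d₂)
    have hp : ‖d₁‖ * ‖d₂‖ ≤ M * M := mul_le_mul hd₁ hd₂ (norm_nonneg _) hM
    have hs : ‖d₁‖ ^ 2 ≤ M ^ 2 := by gcongr
    nlinarith [mul_le_mul hδ1 hs (sq_nonneg _) zero_le_one]
  have herr : 2 * (l₁ / l₀) * (⟪d₁, d₂⟫ - δ * ‖d₁‖ ^ 2)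
      ≤ 2 * (⟪d₁, d₂⟫ - δ * ‖d₁‖ ^ 2) + 4 * M ^ 2 / τ * (l₀ - l₁) := by
    have hr : 1 - l₁ / l₀ ≤ (l₀ - l₁) / τ := by
      have h : 1 - l₁ / l₀ = (l₀ - l₁) / l₀ := by field_simp
      rw [h]
      exact div_le_div_of_nonneg_left (by linarith) hτ (hτl.trans hl)
    have hr0 : 0 ≤ 1 - l₁ / l₀ := sub_nonneg.2 ((div_le_one hl₀).2 hl)
    have e1 := mul_le_mul_of_nonneg_left hX hr0
    have e2 := mul_le_mul_of_nonneg_left hr (by positivity : 0 ≤ 4 * M ^ 2)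
    have e3 : 4 * M ^ 2 / τ * (l₀ - l₁) = 4 * M ^ 2 * ((l₀ - l₁) / τ) := by ring
    rw [e3]
    nlinarith
  have hpolar : 2 * (⟪d₁, d₂⟫ - δ * ‖d₁‖ ^ 2)
      = 1 / δ * ‖d₂‖ ^ 2 - δ * ‖d₁‖ ^ 2 - 1 / δ * ‖d₂ - δ • d₁‖ ^ 2 := by
    rw [norm_sub_sq_real, inner_smul_right, norm_smul, Real.norm_of_nonneg hδ.le,
      real_inner_comm d₁ d₂]
    field_simp
    ring
  have hyoung := two_mul_mul_le_of_sq_le (D := ‖d₁‖) (e := ‖d₂ - δ • d₁‖) (sub_pos.2 hcb) hgap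
  have hyoung' : 2 * (α * ‖q‖ * ‖d₂ - δ • d₁‖) ≤ α * ‖q‖ ^ 2 + α * ‖d₂ - δ • d₁‖ ^ 2 := by
    linarith [mul_nonneg hα (sq_nonneg (‖q‖ - ‖d₂ - δ • d₁‖))]
  have hΘl : τ * (⟪fs, w - d₁⟫ + g₀ - gs) ≤ l₁ * (⟪fs, w - d₁⟫ + g₀ - gs) := by gcongr
  have hΘl' : (1 + δ) * (l₁ * (⟪fs, w - d₁⟫ + g₀ - gs))
      ≤ (1 + δ) * (l₀ * (⟪fs, w - d₁⟫ + g₀ - gs)) := by gcongr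
  linarith

/-- Minty's lemma: a solution of the dual mixed variational inequality solves the primal one. -/
lemma minty_of_lipschitz {F : H → H} {L : ℝ} (hlip : ∀ u v, ‖F u - F v‖ ≤ L * ‖u - v‖)
    {g : H → ℝ} (hg : ConvexOn ℝ Set.univ g) {p : H}
    (h : ∀ z, 0 ≤ ⟪F z, z - p⟫ + g z - g p) (z : H) : 0 ≤ ⟪F p, z - p⟫ + g z - g p := by
  have key : ∀ t : ℝ, 0 < t → t ≤ 1 → 0 ≤ ⟪F p, z - p⟫ + g z - g p + t * (L * ‖z - p‖ ^ 2) := by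
    intro t ht ht1
    have h1 := h (p + t • (z - p))
    have h2 : g (p + t • (z - p)) ≤ (1 - t) * g p + t * g z := by
      have h3 := hg.2 (Set.mem_univ p) (Set.mem_univ z) (by linarith : 0 ≤ 1 - t) ht.le (by ring)
      have h4 : p + t • (z - p) = (1 - t) • p + t • z := by module
      rw [h4]
      simpa using h3
    rw [add_sub_cancel_left, inner_smul_right] at h1
    have h5 : ⟪F (p + t • (z - p)) - F p, z - p⟫ ≤ t * (L * ‖z - p‖ ^ 2) := by
      refine (real_inner_le_norm _ _).trans ?_
      have h6 := hlip (p + t • (z - p)) p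
      rw [add_sub_cancel_left, norm_smul, Real.norm_of_nonneg ht.le] at h6
      nlinarith [mul_le_mul_of_nonneg_right h6 (norm_nonneg (z - p))]
    rw [inner_sub_left] at h5
    have h7 : 0 ≤ t * (⟪F (p + t • (z - p)), z - p⟫ + g z - g p) := by linarith
    linarith [nonneg_of_mul_nonneg_right h7 ht]
  have hlim : Tendsto (fun t : ℝ => ⟪F p, z - p⟫ + g z - g p + t * (L * ‖z - p‖ ^ 2)) (𝓝[>] 0)
      (𝓝 (⟪F p, z - p⟫ + g z - g p + 0 * (L * ‖z - p‖ ^ 2))) :=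
    tendsto_nhdsWithin_of_tendsto_nhds (Continuous.tendsto (by fun_prop) 0)
  rw [zero_mul, add_zero] at hlim
  refine ge_of_tendsto hlim ?_
  filter_upwards [Ioc_mem_nhdsGT (zero_lt_one' ℝ)] with t ht using key t ht.1 ht.2

/-- A perturbed proximal step at `x` with output `x'` and operator evaluated at `y` almost solves
the dual mixed variational inequality. -/
lemma residual_le_of_prox_step {F : H → H} {L : ℝ} (hmono : ∀ u v, 0 ≤ ⟪F u - F v, u - v⟫)
    (hlip : ∀ u v, ‖F u - F v‖ ≤ L * ‖u - v‖) {g : H → ℝ} {x x' y z : H} {l τ : ℝ}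
    (hτ : 0 < τ) (hτl : τ ≤ l) (h : ⟪x' - x + l • F y, z - x'⟫ ≥ l * (g x' - g z)) :
    ⟪F z, x'⟫ + g x' ≤ ⟪F z, z⟫ + g z + (L * ‖x' - y‖ + ‖x' - x‖ / τ) * ‖x' - z‖ := by
  have hl : 0 < l := hτ.trans_le hτl
  have h1 : ⟪x' - x, z - x'⟫ ≤ l * (‖x' - x‖ / τ * ‖x' - z‖) := by
    rw [norm_sub_rev x' z]
    refine (real_inner_le_norm _ _).trans ?_
    have h2 : ‖x' - x‖ ≤ l * (‖x' - x‖ / τ) := by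
      rw [mul_div_assoc', le_div_iff₀ hτ, mul_comm]
      gcongr
    rw [← mul_assoc]
    gcongr
  have h3 : ⟪F y - F x', z - x'⟫ ≤ L * ‖x' - y‖ * ‖x' - z‖ := by
    rw [norm_sub_rev x' z, norm_sub_rev x' y]
    exact (real_inner_le_norm _ _).trans (by gcongr; exact hlip _ _)
  have h4 := hmono z x'
  rw [inner_add_left, inner_smul_left, RCLike.conj_to_real] at h
  have h5 : 0 ≤ l * (⟪F y, z - x'⟫ + ‖x' - x‖ / τ * ‖x' - z‖ - (g x' - g z)) := by linarith
  have h6 := nonneg_of_mul_nonneg_right h5 hl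
  simp only [inner_sub_left, inner_sub_right] at *
  linarith

variable [CompleteSpace H] {ι : Type*}

lemma mem_of_tendsto_inner {C : Set H} (hconv : Convex ℝ C) (hclosed : IsClosed C) {l : Filter ι}
    [l.NeBot] {x : ι → H} {p : H} (hx : ∀ v, Tendsto (fun n => ⟪x n, v⟫) l (𝓝 ⟪p, v⟫))
    (hC : ∀ᶠ n in l, x n ∈ C) : p ∈ C := by
  by_contra hp
  obtain ⟨f, u, hfp, hfC⟩ := geometric_hahn_banach_point_closed hconv hclosed hp
  have hf : ∀ z, f z = ⟪z, (InnerProductSpace.toDual ℝ H).symm f⟫ := fun z => by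
    rw [real_inner_comm, InnerProductSpace.toDual_symm_apply]
  have hlim := hx ((InnerProductSpace.toDual ℝ H).symm f)
  simp only [← hf] at hlim
  have hle : u ≤ f p := ge_of_tendsto hlim (hC.mono fun n hn => (hfC _ hn).le)
  linarith

/-- A bounded family in a Hilbert space converges weakly along every ultrafilter. -/
lemma exists_tendsto_inner_of_bounded (U : Ultrafilter ι) {x : ι → H} {R : ℝ}
    (hR : ∀ᶠ n in (U : Filter ι), ‖x n‖ ≤ R) :
    ∃ p, ∀ v, Tendsto (fun n => ⟪x n, v⟫) U (𝓝 ⟪p, v⟫) := by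
  let T : ι → WeakDual ℝ H := fun n => StrongDual.toWeakDual (InnerProductSpace.toDual ℝ H (x n))
  have hcpt := WeakDual.isCompact_closedBall (𝕜 := ℝ) (E := H) 0 R
  obtain ⟨φ, -, hφ⟩ := hcpt.ultrafilter_le_nhds' (U.map T) (by
    refine hR.mono fun n hn => ?_
    simpa [T] using hn)
  have hT : Tendsto T U (𝓝 φ) := hφ
  refine ⟨(InnerProductSpace.toDual ℝ H).symm (WeakDual.toStrongDual φ), fun v => ?_⟩
  rw [InnerProductSpace.toDual_symm_apply]
  exact ((WeakDual.eval_continuous v).tendsto φ).comp hT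

/-- Opial's lemma, with weak cluster points taken along ultrafilters. -/
lemma exists_tendsto_inner_of_opial {l : Filter ι} [l.NeBot] {S : Set H} (hS : S.Nonempty)
    {x : ι → H} (hfejer : ∀ s ∈ S, ∃ a : ℝ, Tendsto (fun n => ‖x n - s‖ ^ 2) l (𝓝 a))
    (hcluster : ∀ U : Ultrafilter ι, (U : Filter ι) ≤ l → ∀ p,
      (∀ v, Tendsto (fun n => ⟪x n, v⟫) U (𝓝 ⟪p, v⟫)) → p ∈ S) :
    ∃ p ∈ S, ∀ v, Tendsto (fun n => ⟪x n, v⟫) l (𝓝 ⟪p, v⟫) := by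
  obtain ⟨s, hs⟩ := hS
  obtain ⟨a, ha⟩ := hfejer s hs
  have hbdd : ∀ᶠ n in l, ‖x n‖ ≤ ‖s‖ + (a + 2) := by
    filter_upwards [ha.eventually_lt_const (lt_add_one a)] with n hn
    have h1 : ‖x n‖ ≤ ‖s‖ + ‖x n - s‖ := norm_le_insert' _ _
    nlinarith [sq_nonneg (‖x n - s‖ - 1)]
  have hex : ∀ U : Ultrafilter ι, (U : Filter ι) ≤ l →
      ∃ p ∈ S, ∀ v, Tendsto (fun n => ⟪x n, v⟫) U (𝓝 ⟪p, v⟫) := fun U hU => by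
    obtain ⟨p, hp⟩ := exists_tendsto_inner_of_bounded U (hbdd.filter_mono hU)
    exact ⟨p, hcluster U hU p hp, hp⟩
  obtain ⟨p, hpS, hp⟩ := hex (Ultrafilter.of l) (Ultrafilter.of_le l)
  refine ⟨p, hpS, fun v => tendsto_iff_ultrafilter _ _ _ |>.2 fun U hU => ?_⟩
  obtain ⟨q, hqS, hq⟩ := hex U hU
  obtain ⟨b, hb⟩ := hfejer p hpS
  obtain ⟨c, hc⟩ := hfejer q hqS
  have hdiff : Tendsto (fun n => ⟪x n, q - p⟫) l (𝓝 ((b - c - ‖p‖ ^ 2 + ‖q‖ ^ 2) / 2)) := by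
    refine ((((hb.sub hc).sub_const (‖p‖ ^ 2)).add_const (‖q‖ ^ 2)).div_const 2).congr fun n => ?_
    rw [norm_sub_sq_real, norm_sub_sq_real, inner_sub_right]
    ring
  have h1 := tendsto_nhds_unique (hp (q - p)) (hdiff.mono_left (Ultrafilter.of_le l))
  have h2 := tendsto_nhds_unique (hq (q - p)) (hdiff.mono_left hU)
  have hqp : q = p := by
    rw [← sub_eq_zero, ← inner_self_eq_zero (𝕜 := ℝ), inner_sub_left, h1, h2, sub_self]
  exact hqp ▸ hq v

end Hilbert

/-- weak convergence of Algorithm 1 (PEG) for (√5−1)/2 < δ < 1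
(Theorem 2 of the paper). -/
theorem stmt10 {H : Type*} [NormedAddCommGroup H] [InnerProductSpace ℝ H] [CompleteSpace H]
    (F : H → H) (L : ℝ) (hL : 0 < L)
    (hmono : ∀ u v : H, 0 ≤ ⟪F u - F v, u - v⟫)
    (hlip : ∀ u v : H, ‖F u - F v‖ ≤ L * ‖u - v‖)
    (g : H → ℝ) (hgconv : ConvexOn ℝ Set.univ g) (hgcont : Continuous g)
    (S : Set H) (hS : S = {xs : H | ∀ y : H, 0 ≤ ⟪F xs, y - xs⟫ + g y - g xs})
    (hSne : S.Nonempty)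
    (δ α : ℝ) (hδ1 : (Real.sqrt 5 - 1) / 2 < δ) (hδ2 : δ < 1)
    (hα0 : 0 < α) (hακ : α < kappaFn δ)
    (x y : ℕ → H) (lam : ℕ → ℝ)
    (hy : ∀ n : ℕ, 1 ≤ n → y n = x n + δ • (x n - x (n - 1)))
    (hlampos : ∀ n : ℕ, 1 ≤ n → 0 < lam n)
    (hlamdec : ∀ n : ℕ, 1 ≤ n → lam n ≤ lam (n - 1))
    (hlin : ∀ n : ℕ, 1 ≤ n → lam n * ‖F (y n) - F (y (n - 1))‖ ≤ α * ‖y n - y (n - 1)‖)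
    (hstep : ∀ n : ℕ, 1 ≤ n → ∀ z : H,
      ⟪x (n + 1) - x n + lam n • F (y n), z - x (n + 1)⟫ ≥ lam n * (g (x (n + 1)) - g z))
    (hlaminf : ∃ τ : ℝ, 0 < τ ∧ ∀ n : ℕ, τ ≤ lam n)
    (hbound : ∃ M : ℝ, ∀ n : ℕ, ‖x (n + 1) - x n‖ ≤ M) :
    ∃ p ∈ S, ∀ v : H,
      Filter.Tendsto (fun n => ⟪x n, v⟫) Filter.atTop (nhds ⟪p, v⟫) := by
  have hδ0 : 0 < δ := by
    have h5 : 1 < Real.sqrt 5 := Real.lt_sqrt_of_sq_lt (by norm_num)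
    linarith
  obtain ⟨c, hc, hcb, hgap⟩ := exists_gap_of_lt_kappaFn hδ1 hα0 hακ
  obtain ⟨τ, hτ, hτl⟩ := hlaminf
  obtain ⟨M, hM⟩ := hbound
  have hinv : 0 < 1 / δ - 1 := sub_pos.2 ((one_lt_div hδ0).2 hδ2)
  have hlam_lim : ∃ l, Tendsto (fun k => lam (k + 1)) atTop (𝓝 l) :=
    ⟨_, tendsto_atTop_ciInf (antitone_nat_of_succ_le fun n => hlamdec (n + 1 + 1) (by omega))
      ⟨τ, by rintro _ ⟨n, rfl⟩; exact hτl _⟩⟩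
  have hystep : ∀ k, x (k + 3) - y (k + 2) = x (k + 3) - x (k + 2) - δ • (x (k + 2) - x (k + 1)) :=
    fun k => by rw [hy (k + 2) (by omega)]; simp only [Nat.reduceSubDiff]; abel
  have hmain : ∀ s ∈ S, (∃ a, Tendsto (fun n => ‖x n - s‖ ^ 2) atTop (𝓝 a)) ∧
      Tendsto (fun k => ‖x (k + 2) - x (k + 1)‖ ^ 2) atTop (𝓝 0) ∧
      Tendsto (fun k => ‖x (k + 3) - y (k + 2)‖ ^ 2) atTop (𝓝 0) := by
    intro s hs
    have hsol : ∀ z, 0 ≤ ⟪F s, z - s⟫ + g z - g s := by rwa [hS] at hs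
    let Θ : ℕ → ℝ := fun k => ⟪F s, x (k + 1) - s⟫ + g (x (k + 1)) - g s
    have hΘ : ∀ k, 0 ≤ Θ k := fun k => hsol _
    let V : ℕ → ℝ := fun k => ‖x (k + 2) - s‖ ^ 2 - (1 / δ - 1) * ‖x (k + 2) - x (k + 1)‖ ^ 2
      + α * ‖x (k + 2) - y (k + 1)‖ ^ 2 + 2 * lam (k + 1) * (1 + δ) * Θ k
      + 4 * M ^ 2 / τ * lam (k + 1)
    let u : ℕ → ℝ := fun k => c * ‖x (k + 2) - x (k + 1)‖ ^ 2 + c * ‖x (k + 3) - y (k + 2)‖ ^ 2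
      + 2 * τ * Θ k
    have hdesc : ∀ k, V (k + 1) + u k ≤ V k := by
      intro k
      have e₁ : x (k + 2) - s + (x (k + 3) - x (k + 2)) = x (k + 3) - s := by abel
      have e₂ : x (k + 2) - s - (x (k + 2) - x (k + 1)) = x (k + 1) - s := by abel
      have e₃ : x (k + 2) - s + δ • (x (k + 2) - x (k + 1)) = y (k + 2) - s := by
        rw [hy (k + 2) (by omega)]; simp only [Nat.reduceSubDiff]; abel
      have e₄ : δ • (x (k + 2) - x (k + 1)) + (x (k + 2) - y (k + 1)) = y (k + 2) - y (k + 1) := by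
        rw [hy (k + 2) (by omega)]; simp only [Nat.reduceSubDiff]; abel
      have hd := lyapunov_descent (w := x (k + 2) - s) (d₁ := x (k + 2) - x (k + 1))
        (d₂ := x (k + 3) - x (k + 2)) (q := x (k + 2) - y (k + 1)) (f₀ := F (y (k + 1)))
        (f₁ := F (y (k + 2))) (fs := F s) (l₀ := lam (k + 1)) (l₁ := lam (k + 2))
        (g₀ := g (x (k + 1))) (g₁ := g (x (k + 2))) (g₂ := g (x (k + 3))) (gs := g s)
        hδ0 hδ2.le hα0.le hcb hgap hτ (hτl _) (hlamdec (k + 2) (by omega)) (hM (k + 1)) (hM (k + 2))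
        (by simpa only [e₁, neg_sub] using hstep (k + 2) (by omega) s)
        (hstep (k + 1) (by omega) (x (k + 3)))
        (by simpa only [neg_sub] using hstep (k + 1) (by omega) (x (k + 1)))
        (by rw [e₃]; exact hmono _ _)
        (by rw [e₄]; exact hlin (k + 2) (by omega))
        (by rw [e₂]; exact hΘ k)
      rw [e₁, e₂, ← hystep] at hd
      exact hd
    have hu : ∀ k, 0 ≤ u k := fun k => by have := hΘ k; positivity
    have hV : ∀ k, -((1 / δ - 1) * M ^ 2) ≤ V k := fun k => by
      have h1 : (1 / δ - 1) * ‖x (k + 2) - x (k + 1)‖ ^ 2 ≤ (1 / δ - 1) * M ^ 2 := by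
        gcongr
        exact hM (k + 1)
      have h2 := hΘ k
      have h3 := hlampos (k + 1) (by omega)
      have h4 : 0 ≤ ‖x (k + 2) - s‖ ^ 2 + α * ‖x (k + 2) - y (k + 1)‖ ^ 2
        + 2 * lam (k + 1) * (1 + δ) * Θ k + 4 * M ^ 2 / τ * lam (k + 1) := by positivity
      simp only [V]
      linarith
    obtain ⟨⟨a, ha⟩, hu0⟩ := tendsto_of_add_le hV hu hdesc
    have hd0 : Tendsto (fun k => ‖x (k + 2) - x (k + 1)‖ ^ 2) atTop (𝓝 0) := by
      refine tendsto_zero_of_const_mul_le hc (fun k => by positivity) (fun k => ?_) hu0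
      have := hΘ k
      have : 0 ≤ c * ‖x (k + 3) - y (k + 2)‖ ^ 2 + 2 * τ * Θ k := by positivity
      simp only [u]
      linarith
    have he0 : Tendsto (fun k => ‖x (k + 3) - y (k + 2)‖ ^ 2) atTop (𝓝 0) := by
      refine tendsto_zero_of_const_mul_le hc (fun k => by positivity) (fun k => ?_) hu0
      have := hΘ k
      have : 0 ≤ c * ‖x (k + 2) - x (k + 1)‖ ^ 2 + 2 * τ * Θ k := by positivity
      simp only [u]
      linarith
    have hΘ0 : Tendsto Θ atTop (𝓝 0) :=
      tendsto_zero_of_const_mul_le (by positivity : 0 < 2 * τ) hΘ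
        (fun k => le_add_of_nonneg_left (by positivity)) hu0
    obtain ⟨l, hl⟩ := hlam_lim
    refine ⟨⟨a + (1 / δ - 1) * 0 - α * 0 - 2 * l * (1 + δ) * 0 - 4 * M ^ 2 / τ * l, ?_⟩, hd0, he0⟩
    rw [← tendsto_add_atTop_iff_nat 3]
    have hl' := hl.comp (tendsto_add_atTop_nat 1)
    refine (((((ha.comp (tendsto_add_atTop_nat 1)).add
      ((hd0.comp (tendsto_add_atTop_nat 1)).const_mul (1 / δ - 1))).sub (he0.const_mul α)).sub
      (((hl'.const_mul 2).mul_const (1 + δ)).mul (hΘ0.comp (tendsto_add_atTop_nat 1)))).sub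
      (hl'.const_mul (4 * M ^ 2 / τ))).congr fun k => ?_
    simp only [V, Function.comp_apply, add_assoc, Nat.reduceAdd]
    ring
  obtain ⟨s, hs⟩ := hSne
  obtain ⟨⟨a, ha⟩, hd0, he0⟩ := hmain s hs
  have hd : Tendsto (fun k => x (k + 1) - x k) atTop (𝓝 0) := by
    rw [← tendsto_add_atTop_iff_nat 1, tendsto_zero_iff_norm_tendsto_zero]
    simpa using hd0.sqrt
  have he : Tendsto (fun k => x (k + 1) - y k) atTop (𝓝 0) := by
    rw [← tendsto_add_atTop_iff_nat 2, tendsto_zero_iff_norm_tendsto_zero]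
    simpa using he0.sqrt
  refine exists_tendsto_inner_of_opial ⟨s, hs⟩ (fun s hs => (hmain s hs).1) ?_
  intro U hU p hp
  rw [hS]
  refine minty_of_lipschitz hlip hgconv fun z => ?_
  have hp' : ∀ v, Tendsto (fun n => ⟪x (n + 1), v⟫) U (𝓝 ⟪p, v⟫) := fun v => by
    have h := (hp v).add ((hd.mono_left hU).inner (tendsto_const_nhds (x := v)))
    rw [inner_zero_left, add_zero] at h
    exact h.congr fun n => by rw [← inner_add_left, add_sub_cancel]
  have hnorm : Tendsto (fun n => ‖x (n + 1) - s‖) atTop (𝓝 √a) := by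
    simpa using (ha.comp (tendsto_add_atTop_nat 1)).sqrt
  have hres : Tendsto (fun n => (L * ‖x (n + 1) - y n‖ + ‖x (n + 1) - x n‖ / τ)
      * (‖x (n + 1) - s‖ + ‖s - z‖)) atTop (𝓝 0) := by
    simpa using ((he.norm.const_mul L).add (hd.norm.div_const τ)).mul (hnorm.add_const ‖s - z‖)
  have hle : ⟪F z, p⟫ + g p ≤ ⟪F z, z⟫ + g z := by
    refine le_of_forall_pos_le_add fun ε hε => ?_
    have hconv : ConvexOn ℝ Set.univ fun w => ⟪F z, w⟫ + g w :=
      ((innerₛₗ ℝ (F z)).convexOn convex_univ).add hgconv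
    have hcl : IsClosed {w | ⟪F z, w⟫ + g w ≤ ⟪F z, z⟫ + g z + ε} :=
      isClosed_le (by fun_prop) continuous_const
    refine mem_of_tendsto_inner (by simpa using hconv.convex_le (⟪F z, z⟫ + g z + ε)) hcl hp'
      (Eventually.filter_mono hU ?_)
    filter_upwards [hres.eventually_lt_const hε, eventually_ge_atTop 1] with n hn h1
    refine (residual_le_of_prox_step hmono hlip hτ (hτl n) (hstep n h1 z)).trans ?_
    gcongr
    refine le_trans ?_ hn.le
    gcongr
    exact norm_sub_le_norm_sub_add_norm_sub _ _ _
  rw [inner_sub_right]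
  linarith
end

section
/- Let H be a real Hilbert space, let f : H → ℝ be convex and differentiable with gradient F = ∇f, let g : H → ℝ be convex and continuous, and set φ = f + g. Assume x̄ ∈ H satisfies ⟨F(x̄), y−x̄⟩ + g(y) − g(x̄) ≥ 0 for all y ∈ H (equivalently x̄ minimizes φ). Let (√5−1)/2 < δ < 1 and 0 < α < κ(δ). Let x : ℕ → H, y : ℕ → H, λ : ℕ → ℝ satisfy, for all n ≥ 1: y(n) = x(n) + δ(x(n) − x(n−1)); 0 < λ(n) ≤ λ(n−1) with inf_n λ(n) > 0; λ(n)‖F(y(n)) − F(y(n−1))‖ ≤ α‖y(n) − y(n−1)‖; and ⟨x(n+1) − x(n) + λ(n)F(y(n)), x − x(n+1)⟩ ≥ λ(n)(g(x(n+1)) − g(x)) for all x ∈ H. Then sup_n ‖x(n+1) − x(n)‖ < ∞ (the correction step of Algorithm 1 is unnecessary when F is the gradient of a convex function). -/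
open scoped RealInnerProductSpace

/-- The gradient inequality for a differentiable convex function. -/
theorem ConvexOn.add_inner_le_of_hasGradientAt {H : Type*} [NormedAddCommGroup H]
    [InnerProductSpace ℝ H] [CompleteSpace H] {f : H → ℝ} (hf : ConvexOn ℝ Set.univ f)
    {v z : H} (hv : HasGradientAt f v z) (w : H) : f z + ⟪v, w - z⟫ ≤ f w := by
  have hconv : ConvexOn ℝ Set.univ (f ∘ AffineMap.lineMap (k := ℝ) z w) := by
    simpa using hf.comp_affineMap (AffineMap.lineMap (k := ℝ) z w)
  have hderiv : HasDerivAt (f ∘ AffineMap.lineMap (k := ℝ) z w) ⟪v, w - z⟫ 0 := by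
    have hz : HasGradientAt f v (AffineMap.lineMap (k := ℝ) z w 0) := by simpa using hv
    have h := hz.hasFDerivAt.comp_hasDerivAt (0 : ℝ) AffineMap.hasDerivAt_lineMap
    simpa using h
  have h := hconv.le_slope_of_hasDerivAt (Set.mem_univ 0) (Set.mem_univ 1) one_pos hderiv
  simp [slope_def_field] at h
  linarith

/-- The increment of a convex function from `p` to `q` is at most the slope at a point of the
ray beyond `q`. -/
theorem ConvexOn.sub_le_inner_of_hasGradientAt {H : Type*} [NormedAddCommGroup H]
    [InnerProductSpace ℝ H] [CompleteSpace H] {f : H → ℝ} (hf : ConvexOn ℝ Set.univ f)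
    {F : H → H} (hF : ∀ z, HasGradientAt f (F z) z) (p q : H) {δ : ℝ} (hδ : 0 < δ) :
    f q - f p ≤ ⟪F (q + δ • (q - p)), q - p⟫ := by
  have h1 := hf.add_inner_le_of_hasGradientAt (hF q) p
  have h2 := hf.add_inner_le_of_hasGradientAt (hF q) (q + δ • (q - p))
  have h3 := hf.add_inner_le_of_hasGradientAt (hF (q + δ • (q - p))) q
  rw [← neg_sub q p, inner_neg_right] at h1
  rw [add_sub_cancel_left, inner_smul_right] at h2
  rw [sub_add_cancel_left, inner_neg_right, inner_smul_right] at h3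
  have h4 : δ * ⟪F q, q - p⟫ ≤ δ * ⟪F (q + δ • (q - p)), q - p⟫ := by linarith
  have h5 := le_of_mul_le_mul_left h4 hδ
  linarith

theorem norm_one_add_smul_sub_smul_sq_le {H : Type*} [NormedAddCommGroup H]
    [InnerProductSpace ℝ H] (u v : H) {δ : ℝ} (hδ : 0 ≤ δ) :
    ‖(1 + δ) • u - δ • v‖ ^ 2 ≤ (1 + 2 * δ) * ((1 + δ) * ‖u‖ ^ 2 + δ * ‖v‖ ^ 2) := by
  have h : 0 ≤ δ * (1 + δ) * ‖u + v‖ ^ 2 := by positivity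
  rw [norm_add_sq_real] at h
  rw [norm_sub_sq_real, norm_smul, norm_smul, real_inner_smul_left, real_inner_smul_right,
    Real.norm_of_nonneg hδ, Real.norm_of_nonneg (by linarith : 0 ≤ 1 + δ)]
  linarith

/-- The bound on `α` given by `kappaFn` keeps `α * (1 + 2 * δ)` away from `√2`. -/
theorem mul_one_add_two_mul_lt_of_lt_kappaFn {δ α : ℝ} (hδ1 : (Real.sqrt 5 - 1) / 2 < δ)
    (hδ2 : δ < 1) (hακ : α < kappaFn δ) : α * (1 + 2 * δ) < 33 / 25 := by
  have h5 : (2 : ℝ) < Real.sqrt 5 := by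
    rw [Real.lt_sqrt] <;> norm_num
  have h5' := Real.sq_sqrt (show (0 : ℝ) ≤ 5 by norm_num)
  have hδ : 1 / 2 < δ := by linarith
  have hden : 0 < δ ^ 2 + δ - 1 := by nlinarith
  have ha : 0 < aFn δ := div_pos (by positivity) hden
  set s := Real.sqrt (aFn δ + 1) with hs
  have hs0 : 0 < s := Real.sqrt_pos.2 (by linarith)
  have hs2 : s ^ 2 = aFn δ + 1 := Real.sq_sqrt (by linarith)
  have hk : kappaFn δ = 1 / (δ * (1 + s)) := by
    unfold kappaFn
    rw [← hs, ← hs2]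
    field_simp
    ring
  have hlow : (103 / 200 * δ + 19 / 25) / δ ≤ s := by
    apply Real.le_sqrt_of_sq_le
    unfold aFn
    rw [div_pow, div_add_one hden.ne', div_le_div_iff₀ (by positivity) hden]
    nlinarith [sq_nonneg (δ ^ 2 - 3 / 4 * δ), sq_nonneg (δ - 3 / 4), mul_pos hden hden]
  have hlow' : 103 / 200 * δ + 19 / 25 ≤ s * δ := (div_le_iff₀ (by linarith)).1 hlow
  rw [hk, lt_div_iff₀ (by positivity)] at hακ
  have hpos : 0 < δ * (1 + s) := by positivity
  by_contra! h
  have hα : 0 < α := by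
    by_contra! h0
    nlinarith
  nlinarith

/-- One step of the decrease estimate for the objective values `U`, `U'`. -/
theorem proximal_step_decrease {H : Type*} [NormedAddCommGroup H] [InnerProductSpace ℝ H]
    {U U' l l' L E : ℝ} {G d d' : H} (hL : 0 < L) (hLl' : L ≤ l') (hl'l : l' ≤ l)
    (hlL : l ≤ 21 / 20 * L) (hdec : l * (U' - U) ≤ -‖d‖ ^ 2 + l * ⟪G, d⟫)
    (hnext : l * ‖d'‖ ^ 2 ≤ ⟪l' • d - (l * l') • G, d'⟫) (hE : l' ^ 2 * ‖G‖ ^ 2 ≤ E) :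
    2 * L * (U' - U) ≤ -(20 / 21) * ‖d‖ ^ 2 - 20 / 21 * ‖d'‖ ^ 2 + 21 / 20 * E := by
  have hl' : 0 < l' := hL.trans_le hLl'
  have hl : 0 < l := hl'.trans_le hl'l
  have hnorm : l * ‖d'‖ ≤ ‖l' • d - (l * l') • G‖ := by
    rcases (norm_nonneg d').eq_or_lt with h0 | h0
    · rw [← h0]; simp
    · refine le_of_mul_le_mul_right ?_ h0
      calc l * ‖d'‖ * ‖d'‖ = l * ‖d'‖ ^ 2 := by ring
        _ ≤ _ := hnext.trans (real_inner_le_norm _ _)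
  have hsq : (l * ‖d'‖) ^ 2 ≤ ‖l' • d - (l * l') • G‖ ^ 2 := by gcongr
  rw [norm_sub_sq_real, norm_smul, norm_smul, real_inner_smul_left, real_inner_smul_right,
    Real.norm_of_nonneg hl'.le, Real.norm_of_nonneg (by positivity : 0 ≤ l * l'),
    real_inner_comm] at hsq
  have hE0 : 0 ≤ E := le_trans (by positivity) hE
  have hmain : 2 * l * l' ^ 2 * (U' - U) ≤ -(l' ^ 2 * ‖d‖ ^ 2) + l ^ 2 * (E - ‖d'‖ ^ 2) := by
    have h1 := mul_le_mul_of_nonneg_left hdec (by positivity : 0 ≤ 2 * l' ^ 2)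
    have h2 := mul_le_mul_of_nonneg_left hE (by positivity : 0 ≤ l ^ 2)
    linarith
  have hdiv : 2 * L * (U' - U) ≤
      -(L / l * ‖d‖ ^ 2) + L * l / l' ^ 2 * E - L * l / l' ^ 2 * ‖d'‖ ^ 2 := by
    have h := mul_le_mul_of_nonneg_left hmain (by positivity : 0 ≤ L / (l * l' ^ 2))
    have e1 : L / (l * l' ^ 2) * (2 * l * l' ^ 2 * (U' - U)) = 2 * L * (U' - U) := by
      field_simp
    have e2 : L / (l * l' ^ 2) * (-(l' ^ 2 * ‖d‖ ^ 2) + l ^ 2 * (E - ‖d'‖ ^ 2)) =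
        -(L / l * ‖d‖ ^ 2) + L * l / l' ^ 2 * E - L * l / l' ^ 2 * ‖d'‖ ^ 2 := by
      field_simp
      ring
    rwa [e1, e2] at h
  have b1 : 20 / 21 ≤ L / l := by
    rw [le_div_iff₀ hl]; linarith
  have b2 : 20 / 21 ≤ L * l / l' ^ 2 := by
    rw [le_div_iff₀ (by positivity)]; nlinarith
  have b3 : L * l / l' ^ 2 ≤ 21 / 20 := by
    rw [div_le_iff₀ (by positivity)]; nlinarith
  have c1 := mul_le_mul_of_nonneg_right b1 (sq_nonneg ‖d‖)
  have c2 := mul_le_mul_of_nonneg_right b2 (sq_nonneg ‖d'‖)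
  have c3 := mul_le_mul_of_nonneg_right b3 hE0
  linarith

/-- A bound from a second-order Lyapunov inequality with nonnegative values. -/
theorem exists_forall_le_of_lyapunov {U D : ℕ → ℝ} {A p q : ℝ} (hA : 0 < A) (hq : 0 ≤ q)
    (hpq : p + q ≤ 2 * A) (hU : ∀ n, 0 ≤ U n) (hD : ∀ n, 0 ≤ D n) {N : ℕ}
    (hstep : ∀ n, N ≤ n →
      U (n + 1) - U n ≤ -A * D (n + 1) - A * D (n + 2) + (p * D (n + 1) + q * D n)) :
    ∃ M, ∀ n, D n ≤ M := by
  have hW : ∀ n, N ≤ n →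
      U n + A * D (n + 1) + q * D n ≤ U N + A * D (N + 1) + q * D N := by
    intro n hn
    induction n, hn using Nat.le_induction with
    | base => exact le_rfl
    | succ n hn ih =>
      have h1 := hstep n hn
      have h2 := mul_le_mul_of_nonneg_right hpq (hD (n + 1))
      linarith
  have hev : ∀ᶠ n in Filter.atTop, D n ≤ (U N + A * D (N + 1) + q * D N) / A := by
    filter_upwards [Filter.eventually_ge_atTop (N + 1)] with n hn
    obtain ⟨m, rfl⟩ : ∃ m, n = m + 1 := ⟨n - 1, by omega⟩
    rw [le_div_iff₀ hA]
    have h1 := hW m (by omega)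
    have h2 := hU m
    have h3 := mul_nonneg hq (hD m)
    linarith
  obtain ⟨M, hM⟩ := (Filter.isBoundedUnder_of_eventually_le hev).bddAbove_range
  exact ⟨M, fun n => hM ⟨n, rfl⟩⟩

/-- when F = ∇f for a convex function f, the differences ‖x(n+1) − x(n)‖ are
bounded, so the correction step of Algorithm 1 is unnecessary (estimate (22) of the paper). -/
theorem stmt11 {H : Type*} [NormedAddCommGroup H] [InnerProductSpace ℝ H] [CompleteSpace H]
    (f : H → ℝ) (hfconv : ConvexOn ℝ Set.univ f)
    (F : H → H) (hgrad : ∀ z : H, HasGradientAt f (F z) z)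
    (g : H → ℝ) (hgconv : ConvexOn ℝ Set.univ g) (hgcont : Continuous g)
    (xbar : H) (hxbar : ∀ y : H, 0 ≤ ⟪F xbar, y - xbar⟫ + g y - g xbar)
    (δ α : ℝ) (hδ1 : (Real.sqrt 5 - 1) / 2 < δ) (hδ2 : δ < 1)
    (hα0 : 0 < α) (hακ : α < kappaFn δ)
    (x y : ℕ → H) (lam : ℕ → ℝ)
    (hy : ∀ n : ℕ, 1 ≤ n → y n = x n + δ • (x n - x (n - 1)))
    (hlampos : ∀ n : ℕ, 1 ≤ n → 0 < lam n)
    (hlamdec : ∀ n : ℕ, 1 ≤ n → lam n ≤ lam (n - 1))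
    (hlaminf : ∃ τ : ℝ, 0 < τ ∧ ∀ n : ℕ, τ ≤ lam n)
    (hlin : ∀ n : ℕ, 1 ≤ n → lam n * ‖F (y n) - F (y (n - 1))‖ ≤ α * ‖y n - y (n - 1)‖)
    (hstep : ∀ n : ℕ, 1 ≤ n → ∀ z : H,
      ⟪x (n + 1) - x n + lam n • F (y n), z - x (n + 1)⟫ ≥ lam n * (g (x (n + 1)) - g z)) :
    ∃ M : ℝ, ∀ n : ℕ, ‖x (n + 1) - x n‖ ≤ M := by
  have hδ0 : 0 < δ := by
    have h5 : (1 : ℝ) < Real.sqrt 5 := by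
      rw [Real.lt_sqrt] <;> norm_num
    linarith
  have hαδ := mul_one_add_two_mul_lt_of_lt_kappaFn hδ1 hδ2 hακ
  obtain ⟨τ, hτ, hlamτ⟩ := hlaminf
  have hanti : Antitone lam := antitone_nat_of_succ_le fun n => hlamdec (n + 1) (by omega)
  have hbdd : BddBelow (Set.range lam) := ⟨τ, by rintro _ ⟨n, rfl⟩; exact hlamτ n⟩
  obtain ⟨L, hL⟩ : ∃ L, L = ⨅ n, lam n := ⟨_, rfl⟩
  have hLpos : 0 < L := hτ.trans_le (hL ▸ le_ciInf hlamτ)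
  have hLle : ∀ n, L ≤ lam n := fun n => hL ▸ ciInf_le hbdd n
  have hlim : Filter.Tendsto lam Filter.atTop (nhds L) := hL ▸ tendsto_atTop_ciInf hanti hbdd
  obtain ⟨N, hN⟩ := Filter.eventually_atTop.1
    (hlim.eventually (eventually_le_nhds (by linarith : L < 21 / 20 * L)))
  let U : ℕ → ℝ := fun n => 2 * L * (f (x (n + 1)) + g (x (n + 1)) - (f xbar + g xbar))
  let D : ℕ → ℝ := fun n => ‖x (n + 1) - x n‖ ^ 2
  have hU : ∀ n, 0 ≤ U n := by
    intro n
    have h1 := hfconv.add_inner_le_of_hasGradientAt (hgrad xbar) (x (n + 1))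
    have h2 := hxbar (x (n + 1))
    exact mul_nonneg (by linarith) (by linarith)
  have hdecr : ∀ n, N ≤ n → U (n + 1) - U n ≤ -(20 / 21) * D (n + 1) - 20 / 21 * D (n + 2) +
      (21 / 20 * α ^ 2 * (1 + 2 * δ) * (1 + δ) * D (n + 1) +
        21 / 20 * α ^ 2 * (1 + 2 * δ) * δ * D n) := by
    intro n hn
    have hy1 : y (n + 1) = x (n + 1) + δ • (x (n + 1) - x n) := hy (n + 1) (by omega)
    have hy2 : y (n + 2) = x (n + 2) + δ • (x (n + 2) - x (n + 1)) := hy (n + 2) (by omega)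
    have hl := hlampos (n + 1) (by omega)
    have hl' := hlampos (n + 2) (by omega)
    have hprox := hstep (n + 1) (by omega)
    have hprox' := hstep (n + 2) (by omega)
    have hΔy : y (n + 2) - y (n + 1) =
        (1 + δ) • (x (n + 2) - x (n + 1)) - δ • (x (n + 1) - x n) := by
      rw [hy1, hy2]; module
    have hlip : lam (n + 2) * ‖F (y (n + 2)) - F (y (n + 1))‖ ≤ α * ‖y (n + 2) - y (n + 1)‖ :=
      hlin (n + 2) (by omega)
    have hE : lam (n + 2) ^ 2 * ‖F (y (n + 2)) - F (y (n + 1))‖ ^ 2 ≤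
        α ^ 2 * ((1 + 2 * δ) * ((1 + δ) * D (n + 1) + δ * D n)) := by
      calc _ = (lam (n + 2) * ‖F (y (n + 2)) - F (y (n + 1))‖) ^ 2 := by ring
        _ ≤ (α * ‖y (n + 2) - y (n + 1)‖) ^ 2 := by gcongr
        _ = α ^ 2 * ‖y (n + 2) - y (n + 1)‖ ^ 2 := by ring
        _ ≤ _ := by
          rw [hΔy]
          gcongr
          exact norm_one_add_smul_sub_smul_sq_le _ _ hδ0.le
    have hf := hfconv.sub_le_inner_of_hasGradientAt hgrad (x (n + 1)) (x (n + 2)) hδ0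
    rw [← hy2] at hf
    have hdec : lam (n + 1) * ((f (x (n + 2)) + g (x (n + 2)) - (f xbar + g xbar)) -
          (f (x (n + 1)) + g (x (n + 1)) - (f xbar + g xbar))) ≤
        -‖x (n + 2) - x (n + 1)‖ ^ 2 +
          lam (n + 1) * ⟪F (y (n + 2)) - F (y (n + 1)), x (n + 2) - x (n + 1)⟫ := by
      have h := hprox (x (n + 1))
      rw [← neg_sub (x (n + 1 + 1)), inner_neg_right, inner_add_left, real_inner_smul_left,
        real_inner_self_eq_norm_sq] at h
      rw [inner_sub_left]
      have h2 := mul_le_mul_of_nonneg_left hf hl.le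
      simp only [add_assoc, Nat.reduceAdd] at h
      linarith
    have hnext : lam (n + 1) * ‖x (n + 3) - x (n + 2)‖ ^ 2 ≤
        ⟪lam (n + 2) • (x (n + 2) - x (n + 1)) - (lam (n + 1) * lam (n + 2)) •
          (F (y (n + 2)) - F (y (n + 1))), x (n + 3) - x (n + 2)⟫ := by
      have h := mul_le_mul_of_nonneg_left (hprox (x (n + 3))) hl'.le
      have h' := mul_le_mul_of_nonneg_left (hprox' (x (n + 2))) hl.le
      simp only [add_assoc, Nat.reduceAdd] at h h'
      rw [inner_add_left, real_inner_smul_left] at h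
      rw [← neg_sub (x (n + 3)), inner_neg_right, inner_add_left, real_inner_smul_left,
        real_inner_self_eq_norm_sq] at h'
      rw [inner_sub_left, real_inner_smul_left, real_inner_smul_left, inner_sub_left (F _)]
      linarith
    have h := proximal_step_decrease hLpos (hLle (n + 2)) (hanti (by omega))
      (hN (n + 1) (by omega)) hdec hnext hE
    have hUd : U (n + 1) - U n =
        2 * L * ((f (x (n + 2)) + g (x (n + 2)) - (f xbar + g xbar)) -
          (f (x (n + 1)) + g (x (n + 1)) - (f xbar + g xbar))) := by
      simp only [U]; ring
    rw [hUd]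
    refine h.trans_eq ?_
    simp only [D]
    ring
  have hpq : 21 / 20 * α ^ 2 * (1 + 2 * δ) * (1 + δ) + 21 / 20 * α ^ 2 * (1 + 2 * δ) * δ ≤
      2 * (20 / 21) := by
    have h : (α * (1 + 2 * δ)) ^ 2 ≤ (33 / 25) ^ 2 := by gcongr
    linarith
  obtain ⟨M, hM⟩ := exists_forall_le_of_lyapunov (D := D) (by norm_num) (by positivity) hpq hU
    (fun _ => sq_nonneg _) hdecr
  exact ⟨Real.sqrt M, fun n => Real.le_sqrt_of_sq_le (hM n)⟩
end

section
/- Let H be a real Hilbert space, let F : H → H be monotone and L-Lipschitz (L > 0), let g : H → ℝ be convex and continuous, and assume the solution set S = {x* : ⟨F(x*), y−x*⟩ + g(y) − g(x*) ≥ 0 for all y ∈ H} is nonempty. Let δ > (√5−1)/2 and 0 < α < κ(δ). Let φ : ℕ → ℝ be a sequence with 1 ≤ φ(n) ≤ (1+δ)/δ for all n and φ(n) = 1 for all n ≥ n₀ (for some n₀ ∈ ℕ). Let x : ℕ → H, y : ℕ → H, λ : ℕ → ℝ satisfy, for all n ≥ 1: y(n) = x(n) + δ(x(n) − x(n−1));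 0 < λ(n) ≤ φ(n−1)·λ(n−1); λ(n)‖F(y(n)) − F(y(n−1))‖ ≤ α‖y(n) − y(n−1)‖; and ⟨x(n+1) − x(n) + λ(n)F(y(n)), x − x(n+1)⟩ ≥ λ(n)(g(x(n+1)) − g(x)) for all x ∈ H. Assume moreover inf_n λ(n) > 0 and sup_n ‖x(n+1) − x(n)‖ < ∞. Then the sequence {x(n)} converges weakly to some point of S. -/
open scoped RealInnerProductSpace

lemma quadratic_form_lower_bound {δ α r : ℝ} (hδ : 0 < δ) (hb : 0 < δ ^ 2 + δ - 1) (hr : 1 < r)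
    (hrb : (r ^ 2 - 1) * (δ ^ 2 + δ - 1) = δ ^ 2) (hα : 0 < α) (hk : α * (δ * (1 + r)) < 1) :
    ∃ η > 0, ∃ ρ < 1, ∀ θ D B B' : ℝ, ρ ≤ θ →
      η * D ^ 2 ≤ (θ * δ + 1 - 1 / δ) * D ^ 2 + (θ / δ - 1 / (δ * (1 + r))) * B' ^ 2
        + 1 / (δ * (1 + r)) * B ^ 2 - 2 * α * (δ * D + B) * B' := by
  set b := δ ^ 2 + δ - 1 with hbdef
  set k := α * (δ * (1 + r)) with hkdef
  have hr1 : 0 < 1 + r := by linarith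
  have hk0 : 0 < k := by positivity
  have hk1 : 0 < 1 - k := by linarith
  refine ⟨(1 - k) * b / (2 * δ), by positivity,
    1 - (1 - k) * min (r / (1 + r)) (b / (2 * δ ^ 2)), ?_, ?_⟩
  · have : 0 < min (r / (1 + r)) (b / (2 * δ ^ 2)) := lt_min (by positivity) (by positivity)
    have := mul_pos hk1 this
    linarith
  intro θ D B B' hθ
  have h1 : (1 - θ) * (1 + r) ≤ (1 - k) * r := by
    have h : 1 - θ ≤ (1 - k) * (r / (1 + r)) := by
      have := mul_le_mul_of_nonneg_left (min_le_left (r / (1 + r)) (b / (2 * δ ^ 2))) hk1.le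
      linarith
    calc (1 - θ) * (1 + r) ≤ (1 - k) * (r / (1 + r)) * (1 + r) := by gcongr
      _ = (1 - k) * r := by field_simp
  have h2 : (1 - θ) * δ ^ 2 ≤ (1 - k) * b / 2 := by
    have h : 1 - θ ≤ (1 - k) * (b / (2 * δ ^ 2)) := by
      have := mul_le_mul_of_nonneg_left (min_le_right (r / (1 + r)) (b / (2 * δ ^ 2))) hk1.le
      linarith
    calc (1 - θ) * δ ^ 2 ≤ (1 - k) * (b / (2 * δ ^ 2)) * δ ^ 2 := by gcongr
      _ = (1 - k) * b / 2 := by field_simp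
  have hpsd : 0 ≤ (1 + r) * b * D ^ 2 + B ^ 2 + r * B' ^ 2 - 2 * (δ * D + B) * B' := by
    have h : 0 ≤ (r - 1) * ((1 + r) * b * D ^ 2 + B ^ 2 + r * B' ^ 2 - 2 * (δ * D + B) * B') := by
      have : (r - 1) * ((1 + r) * b * D ^ 2 + B ^ 2 + r * B' ^ 2 - 2 * (δ * D + B) * B')
          = (r - 1) * (B - B') ^ 2 + ((r - 1) * B' - δ * D) ^ 2 := by
        linear_combination D ^ 2 * hrb
      rw [this]
      have : 0 < r - 1 := by linarith
      positivity
    exact nonneg_of_mul_nonneg_right h (by linarith)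
  rw [← sub_nonneg]
  have key : ((θ * δ + 1 - 1 / δ) * D ^ 2 + (θ / δ - 1 / (δ * (1 + r))) * B' ^ 2
        + 1 / (δ * (1 + r)) * B ^ 2 - 2 * α * (δ * D + B) * B' - (1 - k) * b / (2 * δ) * D ^ 2)
      = 1 / (δ * (1 + r)) * (k * ((1 + r) * b * D ^ 2 + B ^ 2 + r * B' ^ 2 - 2 * (δ * D + B) * B')
        + (1 - k) * B ^ 2 + ((1 - k) * r - (1 - θ) * (1 + r)) * B' ^ 2
        + (1 + r) * ((1 - k) * b / 2 - (1 - θ) * δ ^ 2) * D ^ 2) := by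
    rw [hkdef, hbdef]
    field_simp
    ring
  rw [key]
  have := sub_nonneg.2 h1
  have := sub_nonneg.2 h2
  positivity

lemma extrapolated_step_energy {H : Type*} [NormedAddCommGroup H] [InnerProductSpace ℝ H]
    {x₀ x₁ x₂ y₀ y₁ p f₀ f₁ fp : H} {l₀ θ g₀ g₁ g₂ gp δ α : ℝ} (hδ : 0 < δ) (hθ : 0 ≤ θ)
    (hy : y₁ = x₁ + δ • (x₁ - x₀)) (hl₀ : 0 ≤ l₀)
    (h₀₂ : l₀ * (g₁ - g₂) ≤ ⟪x₁ - x₀ + l₀ • f₀, x₂ - x₁⟫)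
    (h₀₀ : l₀ * (g₁ - g₀) ≤ ⟪x₁ - x₀ + l₀ • f₀, x₀ - x₁⟫)
    (h₁ : θ * l₀ * (g₂ - gp) ≤ ⟪x₂ - x₁ + (θ * l₀) • f₁, p - x₂⟫)
    (hmono : 0 ≤ ⟪f₁ - fp, y₁ - p⟫)
    (hlin : θ * l₀ * ‖f₁ - f₀‖ ≤ α * ‖y₁ - y₀‖) (hα : 0 ≤ α) :
    ‖x₂ - p‖ ^ 2 ≤ ‖x₁ - p‖ ^ 2 - ‖x₂ - x₁‖ ^ 2
      + θ / δ * (‖x₂ - x₁‖ ^ 2 - δ ^ 2 * ‖x₁ - x₀‖ ^ 2 - ‖x₂ - y₁‖ ^ 2)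
      + 2 * α * (δ * ‖x₁ - x₀‖ + ‖x₁ - y₀‖) * ‖x₂ - y₁‖
      - 2 * (θ * l₀) * ((1 + δ) * (⟪fp, x₁ - p⟫ + g₁ - gp)
        - δ * (⟪fp, x₀ - p⟫ + g₀ - gp)) := by
  have htri : ‖y₁ - y₀‖ ≤ δ * ‖x₁ - x₀‖ + ‖x₁ - y₀‖ := by
    have : y₁ - y₀ = δ • (x₁ - x₀) + (x₁ - y₀) := by rw [hy]; abel
    rw [this]
    refine (norm_add_le _ _).trans ?_
    rw [norm_smul, Real.norm_of_nonneg hδ.le]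
  have hcs : θ * l₀ * ⟪f₁ - f₀, y₁ - x₂⟫
      ≤ α * (δ * ‖x₁ - x₀‖ + ‖x₁ - y₀‖) * ‖x₂ - y₁‖ := by
    calc θ * l₀ * ⟪f₁ - f₀, y₁ - x₂⟫ ≤ θ * l₀ * (‖f₁ - f₀‖ * ‖y₁ - x₂‖) := by
          gcongr; exact real_inner_le_norm _ _
      _ = θ * l₀ * ‖f₁ - f₀‖ * ‖x₂ - y₁‖ := by rw [norm_sub_rev y₁ x₂]; ring
      _ ≤ α * (δ * ‖x₁ - x₀‖ + ‖x₁ - y₀‖) * ‖x₂ - y₁‖ := by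
          exact mul_le_mul_of_nonneg_right
            (hlin.trans (mul_le_mul_of_nonneg_left htri hα)) (norm_nonneg _)
  have e₀₂ := mul_le_mul_of_nonneg_left h₀₂ hθ
  have e₀₀ := mul_le_mul_of_nonneg_left h₀₀ (mul_nonneg hδ.le hθ)
  have em := mul_nonneg (mul_nonneg hθ hl₀) hmono
  have hq : θ / δ * (‖x₂ - x₁‖ ^ 2 - δ ^ 2 * ‖x₁ - x₀‖ ^ 2 - ‖x₂ - y₁‖ ^ 2)
      = 2 * θ * ⟪x₁ - x₀, x₂ - y₁⟫ := by
    have : x₂ - x₁ = (x₂ - y₁) + δ • (x₁ - x₀) := by rw [hy]; abel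
    rw [this, norm_add_sq_real, norm_smul, real_inner_smul_right, Real.norm_of_nonneg hδ.le,
      real_inner_comm]
    field_simp
    ring
  have hn : ‖x₂ - p‖ ^ 2 = ‖x₁ - p‖ ^ 2 - ‖x₂ - x₁‖ ^ 2 - 2 * ⟪x₂ - x₁, p - x₂⟫ := by
    have h := norm_sub_sq_real (x₂ - p) (x₂ - x₁)
    rw [show x₂ - p - (x₂ - x₁) = x₁ - p by abel, real_inner_comm] at h
    rw [h, ← neg_sub x₂ p, inner_neg_right]
    ring
  rw [hq, hn]
  subst hy
  simp only [inner_add_left, inner_add_right, inner_sub_left, inner_sub_right,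
    real_inner_smul_left, real_inner_smul_right] at *
  linarith

lemma exists_weak_limit_of_bounded {H : Type*} [NormedAddCommGroup H] [InnerProductSpace ℝ H]
    [CompleteSpace H] {ι : Type*} (U : Ultrafilter ι) {x : ι → H} {C : ℝ} (hC : ∀ i, ‖x i‖ ≤ C) :
    ∃ q : H, ∀ v : H, Filter.Tendsto (fun i => ⟪x i, v⟫) U (nhds ⟪q, v⟫) := by
  have hbd : ∀ (v : H) (i : ι), |⟪x i, v⟫| ≤ C * ‖v‖ := fun v i =>
    (abs_real_inner_le_norm _ _).trans (by gcongr; exact hC i)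
  have hlim : ∀ v : H, ∃ l : ℝ, Filter.Tendsto (fun i => ⟪x i, v⟫) U (nhds l) := by
    intro v
    obtain ⟨l, -, hl⟩ := (isCompact_Icc (a := -(C * ‖v‖)) (b := C * ‖v‖)).ultrafilter_le_nhds
      (U.map fun i => ⟪x i, v⟫) (by
        rw [Filter.le_principal_iff]
        exact Filter.eventually_map.2 (Filter.Eventually.of_forall fun i => abs_le.1 (hbd v i)))
    exact ⟨l, hl⟩
  choose ℓ hℓ using hlim
  let f : H →ₗ[ℝ] ℝ :=
    { toFun := ℓ
      map_add' := fun u v => tendsto_nhds_unique (hℓ (u + v)) (by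
        simpa only [inner_add_right] using (hℓ u).add (hℓ v))
      map_smul' := fun c v => tendsto_nhds_unique (hℓ (c • v)) (by
        simpa only [real_inner_smul_right, smul_eq_mul, RingHom.id_apply] using (hℓ v).const_mul c) }
  let f' : H →L[ℝ] ℝ := f.mkContinuous C fun v =>
    le_of_tendsto (hℓ v).abs (Filter.Eventually.of_forall (hbd v))
  refine ⟨(InnerProductSpace.toDual ℝ H).symm f', fun v => ?_⟩
  rw [InnerProductSpace.toDual_symm_apply]
  exact hℓ v

/-- A convex lower level set of a continuous function is stable under weak limits. -/
lemma ConvexOn.le_of_weak_limit {H : Type*} [NormedAddCommGroup H] [InnerProductSpace ℝ H]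
    [CompleteSpace H] {ι : Type*} {l : Filter ι} [l.NeBot] {x : ι → H} {q : H} {h : H → ℝ} {c : ℝ}
    (hconv : ConvexOn ℝ Set.univ h) (hcont : Continuous h)
    (hq : ∀ v : H, Filter.Tendsto (fun i => ⟪x i, v⟫) l (nhds ⟪q, v⟫))
    (hle : ∀ᶠ i in l, h (x i) ≤ c) : h q ≤ c := by
  by_contra hlt
  have hs : Convex ℝ {z | h z ≤ c} := by simpa using hconv.convex_le c
  obtain ⟨f, u, hf, hu⟩ := geometric_hahn_banach_closed_point hs
    (isClosed_le hcont continuous_const) (x := q) hlt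
  have hfx : ∀ z, f z = ⟪z, (InnerProductSpace.toDual ℝ H).symm f⟫ := fun z => by
    rw [real_inner_comm, InnerProductSpace.toDual_symm_apply]
  have hlim : Filter.Tendsto (fun i => f (x i)) l (nhds (f q)) := by
    simpa only [hfx] using hq _
  have : f q ≤ u := le_of_tendsto hlim (hle.mono fun i hi => (hf _ hi).le)
  linarith

/-- Minty's lemma. -/
lemma minty {H : Type*} [NormedAddCommGroup H] [InnerProductSpace ℝ H] {F : H → H} {g : H → ℝ}
    (hF : Continuous F) (hg : ConvexOn ℝ Set.univ g) {q : H}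
    (h : ∀ z, ⟪F z, q - z⟫ + g q - g z ≤ 0) (w : H) : 0 ≤ ⟪F q, w - q⟫ + g w - g q := by
  have hle : ∀ t ∈ Set.Ioo (0 : ℝ) 1, 0 ≤ ⟪F (q + t • (w - q)), w - q⟫ + g w - g q := by
    rintro t ⟨ht0, ht1⟩
    have h1 := h (q + t • (w - q))
    have h2 := hg.2 (Set.mem_univ q) (Set.mem_univ w) (by linarith : 0 ≤ 1 - t) ht0.le (by ring)
    have e1 : (1 - t) • q + t • w = q + t • (w - q) := by module
    have e2 : q - (q + t • (w - q)) = -(t • (w - q)) := by abel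
    rw [e1, smul_eq_mul, smul_eq_mul] at h2
    rw [e2, inner_neg_right, real_inner_smul_right] at h1
    have : 0 ≤ t * (⟪F (q + t • (w - q)), w - q⟫ + g w - g q) := by linarith
    exact nonneg_of_mul_nonneg_right this ht0
  have hc : Continuous fun t : ℝ => ⟪F (q + t • (w - q)), w - q⟫ + g w - g q := by fun_prop
  have hlim : Filter.Tendsto (fun t : ℝ => ⟪F (q + t • (w - q)), w - q⟫ + g w - g q)
      (nhdsWithin 0 (Set.Ioi 0)) (nhds (⟪F q, w - q⟫ + g w - g q)) := by
    simpa using (hc.tendsto 0).mono_left nhdsWithin_le_nhds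
  exact ge_of_tendsto hlim
    (Filter.eventually_of_mem (Ioo_mem_nhdsGT one_pos) hle)

/-- Opial's lemma. -/
lemma exists_weak_limit_of_fejer {H : Type*} [NormedAddCommGroup H] [InnerProductSpace ℝ H]
    [CompleteSpace H] {S : Set H} {x : ℕ → H} {C : ℝ} (hC : ∀ n, ‖x n‖ ≤ C)
    (hS : ∀ p ∈ S, ∃ m : ℝ, Filter.Tendsto (fun n => ‖x n - p‖ ^ 2) Filter.atTop (nhds m))
    (hcluster : ∀ (U : Ultrafilter ℕ) (q : H), (U : Filter ℕ) ≤ Filter.atTop →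
      (∀ v : H, Filter.Tendsto (fun n => ⟪x n, v⟫) U (nhds ⟪q, v⟫)) → q ∈ S) :
    ∃ p ∈ S, ∀ v : H, Filter.Tendsto (fun n => ⟪x n, v⟫) Filter.atTop (nhds ⟪p, v⟫) := by
  have hU₀ := Ultrafilter.of_le (Filter.atTop : Filter ℕ)
  obtain ⟨p, hp⟩ := exists_weak_limit_of_bounded (Ultrafilter.of Filter.atTop) hC
  have hpS := hcluster _ p hU₀ hp
  refine ⟨p, hpS, fun v => ?_⟩
  rw [Filter.tendsto_iff_ultrafilter]
  intro U hU
  obtain ⟨q, hq⟩ := exists_weak_limit_of_bounded U hC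
  have hqS := hcluster U q hU hq
  suffices h : q = p by rw [← h]; exact hq v
  obtain ⟨m, hm⟩ := hS p hpS
  obtain ⟨m', hm'⟩ := hS q hqS
  have hlim : Filter.Tendsto (fun n => ⟪x n, q - p⟫) Filter.atTop
      (nhds ((m - m' - ‖p‖ ^ 2 + ‖q‖ ^ 2) / 2)) := by
    refine (((hm.sub hm').sub_const (‖p‖ ^ 2)).add_const (‖q‖ ^ 2)).div_const 2 |>.congr ?_
    intro n
    rw [norm_sub_sq_real, norm_sub_sq_real, inner_sub_right]
    ring
  have h1 := tendsto_nhds_unique (hp (q - p)) (hlim.mono_left hU₀)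
  have h2 := tendsto_nhds_unique (hq (q - p)) (hlim.mono_left hU)
  rw [← sub_eq_zero, ← inner_self_eq_zero (𝕜 := ℝ), inner_sub_left, h1, h2, sub_self]

lemma tendsto_of_eventually_add_le {V e : ℕ → ℝ} {c : ℝ} (hV : ∀ n, c ≤ V n) (he : ∀ n, 0 ≤ e n)
    (h : ∀ᶠ n in Filter.atTop, V (n + 1) + e n ≤ V n) :
    (∃ m, Filter.Tendsto V Filter.atTop (nhds m)) ∧
      Filter.Tendsto e Filter.atTop (nhds 0) := by
  obtain ⟨N, hN⟩ := Filter.eventually_atTop.1 h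
  have hanti : Antitone fun n => V (n + N) := antitone_nat_of_succ_le fun n => by
    have := hN (n + N) (by omega)
    have := he (n + N)
    rw [show n + 1 + N = n + N + 1 by omega]
    linarith
  have hlim := tendsto_atTop_ciInf hanti ⟨c, by rintro _ ⟨n, rfl⟩; exact hV _⟩
  have hm := (Filter.tendsto_add_atTop_iff_nat N).1 hlim
  refine ⟨⟨_, hm⟩, ?_⟩
  have hdiff := hm.sub (hm.comp (Filter.tendsto_add_atTop_nat 1))
  rw [sub_self] at hdiff
  refine tendsto_of_tendsto_of_tendsto_of_le_of_le' tendsto_const_nhds hdiff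
    (Filter.Eventually.of_forall he) (h.mono fun n hn => ?_)
  simp only [Function.comp]
  linarith

lemma step_residual_bound {H : Type*} [NormedAddCommGroup H] [InnerProductSpace ℝ H]
    {F : H → H} {L : ℝ} (hL : 0 < L) (hmono : ∀ u v : H, 0 ≤ ⟪F u - F v, u - v⟫)
    (hlip : ∀ u v : H, ‖F u - F v‖ ≤ L * ‖u - v‖) {a b w z : H} {l τ s t K : ℝ} (hτ : 0 < τ)
    (hl : τ ≤ l) (hK : ‖b - z‖ ≤ K)
    (hstep : l * (s - t) ≤ ⟪b - a + l • F w, z - b⟫) :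
    ⟪F z, b - z⟫ + s - t ≤ ‖b - a‖ * K / τ + L * (‖b - w‖ + K) * ‖b - w‖ := by
  have hl0 : 0 < l := hτ.trans_le hl
  have hK0 : 0 ≤ K := (norm_nonneg _).trans hK
  have h1 : ⟪b - a, z - b⟫ ≤ ‖b - a‖ * K :=
    (real_inner_le_norm _ _).trans (by rw [norm_sub_rev z b]; gcongr)
  have h2 : ⟪F w - F z, w - b⟫ ≤ L * (‖b - w‖ + K) * ‖b - w‖ := by
    refine (real_inner_le_norm _ _).trans ?_
    rw [norm_sub_rev w b]
    gcongr
    refine (hlip w z).trans ?_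
    gcongr
    calc ‖w - z‖ ≤ ‖w - b‖ + ‖b - z‖ := norm_sub_le_norm_sub_add_norm_sub _ _ _
      _ ≤ ‖b - w‖ + K := by rw [norm_sub_rev w b]; gcongr
  have h3 : ⟪F w - F z, z - b⟫ ≤ ⟪F w - F z, w - b⟫ := by
    have := hmono w z
    rw [show w - z = (w - b) - (z - b) by abel, inner_sub_right] at this
    linarith
  have h4 : l * (⟪F z, b - z⟫ + s - t) ≤ ⟪b - a, z - b⟫ + l * ⟪F w - F z, z - b⟫ := by
    rw [inner_add_left, real_inner_smul_left] at hstep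
    rw [← neg_sub z b, inner_neg_right, inner_sub_left (F w)]
    linarith
  have h5 : ⟪F z, b - z⟫ + s - t - L * (‖b - w‖ + K) * ‖b - w‖ ≤ ‖b - a‖ * K / l := by
    rw [le_div_iff₀ hl0]
    have := mul_le_mul_of_nonneg_left (h3.trans h2) hl0.le
    linarith
  have h6 : ‖b - a‖ * K / l ≤ ‖b - a‖ * K / τ := by gcongr
  linarith

/-- weak convergence of Algorithm 2 (improved PEG with nonmonotonic step size,
Theorem 4 of the paper). -/
theorem stmt13 {H : Type*} [NormedAddCommGroup H] [InnerProductSpace ℝ H] [CompleteSpace H]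
    (F : H → H) (L : ℝ) (hL : 0 < L)
    (hmono : ∀ u v : H, 0 ≤ ⟪F u - F v, u - v⟫)
    (hlip : ∀ u v : H, ‖F u - F v‖ ≤ L * ‖u - v‖)
    (g : H → ℝ) (hgconv : ConvexOn ℝ Set.univ g) (hgcont : Continuous g)
    (S : Set H) (hS : S = {xs : H | ∀ y : H, 0 ≤ ⟪F xs, y - xs⟫ + g y - g xs})
    (hSne : S.Nonempty)
    (δ α : ℝ) (hδ : (Real.sqrt 5 - 1) / 2 < δ) (hα0 : 0 < α) (hακ : α < kappaFn δ)
    (φ : ℕ → ℝ) (n₀ : ℕ)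
    (hφ : ∀ n : ℕ, 1 ≤ φ n ∧ φ n ≤ (1 + δ) / δ)
    (hφ1 : ∀ n : ℕ, n₀ ≤ n → φ n = 1)
    (x y : ℕ → H) (lam : ℕ → ℝ)
    (hy : ∀ n : ℕ, 1 ≤ n → y n = x n + δ • (x n - x (n - 1)))
    (hlampos : ∀ n : ℕ, 1 ≤ n → 0 < lam n)
    (hlamle : ∀ n : ℕ, 1 ≤ n → lam n ≤ φ (n - 1) * lam (n - 1))
    (hlin : ∀ n : ℕ, 1 ≤ n → lam n * ‖F (y n) - F (y (n - 1))‖ ≤ α * ‖y n - y (n - 1)‖)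
    (hstep : ∀ n : ℕ, 1 ≤ n → ∀ z : H,
      ⟪x (n + 1) - x n + lam n • F (y n), z - x (n + 1)⟫ ≥ lam n * (g (x (n + 1)) - g z))
    (hlaminf : ∃ τ : ℝ, 0 < τ ∧ ∀ n : ℕ, τ ≤ lam n)
    (hbound : ∃ M : ℝ, ∀ n : ℕ, ‖x (n + 1) - x n‖ ≤ M) :
    ∃ p ∈ S, ∀ v : H,
      Filter.Tendsto (fun n => ⟪x n, v⟫) Filter.atTop (nhds ⟪p, v⟫) := by
  obtain ⟨τ, hτ, hlam⟩ := hlaminf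
  obtain ⟨M, hM⟩ := hbound
  have hlam0 : ∀ n, 0 < lam n := fun n => hτ.trans_le (hlam n)
  have hs5 : Real.sqrt 5 ^ 2 = 5 := Real.sq_sqrt (by norm_num)
  have hs5' : 1 < Real.sqrt 5 := by rw [Real.lt_sqrt] <;> norm_num
  have hδ0 : 0 < δ := by linarith
  have hb : 0 < δ ^ 2 + δ - 1 := by nlinarith
  have ha : 0 < aFn δ := by unfold aFn; positivity
  obtain ⟨r, hr⟩ : ∃ r, r = Real.sqrt (aFn δ + 1) := ⟨_, rfl⟩
  have hr2 : r ^ 2 = aFn δ + 1 := by rw [hr]; exact Real.sq_sqrt (by linarith)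
  have hr1 : 1 < r := by rw [hr, Real.lt_sqrt] <;> linarith
  have hrb : (r ^ 2 - 1) * (δ ^ 2 + δ - 1) = δ ^ 2 := by
    rw [hr2, aFn, add_sub_cancel_right, div_mul_cancel₀ _ hb.ne']
  have hk : α * (δ * (1 + r)) < 1 := by
    have : kappaFn δ = 1 / (δ * (1 + r)) := by
      rw [kappaFn, ← hr, ← hr2]; field_simp; ring
    rwa [this, lt_div_iff₀ (by positivity)] at hακ
  obtain ⟨η, hη, ρ, hρ, hform⟩ := quadratic_form_lower_bound hδ0 hb hr1 hrb hα0 hk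
  set ν := 1 / (δ * (1 + r)) with hν
  have hν0 : 0 < ν := by positivity
  have hlamanti : ∀ n, n₀ ≤ n → lam (n + 1) ≤ lam n := fun n hn => by
    simpa [hφ1 n hn] using hlamle (n + 1) (by omega)
  obtain ⟨⟨ℓ, hℓ⟩, -⟩ := tendsto_of_eventually_add_le (e := fun _ => 0) hlam (fun _ => le_rfl)
    (Filter.eventually_atTop.2 ⟨n₀, fun n hn => by simpa using hlamanti n hn⟩)
  have hℓ0 : 0 < ℓ := hτ.trans_le (ge_of_tendsto' hℓ hlam)
  have hratio : Filter.Tendsto (fun n => lam (n + 1) / lam n) Filter.atTop (nhds 1) := by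
    have := (hℓ.comp (Filter.tendsto_add_atTop_nat 1)).div hℓ hℓ0.ne'
    rwa [div_self hℓ0.ne'] at this
  have hFc : Continuous F :=
    (LipschitzWith.of_dist_le_mul (K := ⟨L, hL.le⟩) fun u v => by
      rw [dist_eq_norm, dist_eq_norm]; exact hlip u v).continuous
  let G : H → H → ℝ := fun p z => ⟪F p, z - p⟫ + g z - g p
  have hG : ∀ p ∈ S, ∀ z, 0 ≤ G p z := fun p hp z => by rw [hS] at hp; exact hp z
  let V : H → ℕ → ℝ := fun p n => ‖x (n + 1) - p‖ ^ 2 + 2 * (1 + δ) * (lam n * G p (x n))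
    + (1 - 1 / δ) * ‖x (n + 1) - x n‖ ^ 2 + ν * ‖x (n + 1) - y n‖ ^ 2
  have hVlow : ∀ p ∈ S, ∀ n, ‖x (n + 1) - p‖ ^ 2 - 1 / δ * M ^ 2 ≤ V p n := by
    intro p hp n
    have h1 : 0 ≤ 2 * (1 + δ) * (lam n * G p (x n)) :=
      mul_nonneg (by positivity) (mul_nonneg (hlam0 n).le (hG p hp _))
    have h2 : 1 / δ * ‖x (n + 1) - x n‖ ^ 2 ≤ 1 / δ * M ^ 2 := by gcongr; exact hM n
    have h3 : 0 ≤ ‖x (n + 1) - x n‖ ^ 2 := by positivity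
    have h4 : 0 ≤ ν * ‖x (n + 1) - y n‖ ^ 2 := by positivity
    simp only [V]
    linarith
  have hVconv : ∀ p ∈ S, (∃ m, Filter.Tendsto (V p) Filter.atTop (nhds m)) ∧
      Filter.Tendsto (fun n => η * ‖x (n + 1) - x n‖ ^ 2) Filter.atTop (nhds 0) := by
    intro p hp
    refine tendsto_of_eventually_add_le (c := -(1 / δ * M ^ 2)) (fun n => ?_)
      (fun n => by positivity) ?_
    · have := hVlow p hp n
      have : 0 ≤ ‖x (n + 1) - p‖ ^ 2 := by positivity
      linarith
    filter_upwards [Filter.eventually_ge_atTop n₀, Filter.eventually_ge_atTop 1,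
      hratio.eventually (lt_mem_nhds hρ)] with n hn hn1 hρn
    have hθl : lam (n + 1) / lam n * lam n = lam (n + 1) := div_mul_cancel₀ _ (hlam0 n).ne'
    have hen := extrapolated_step_energy (x₀ := x n) (x₁ := x (n + 1)) (x₂ := x (n + 2))
      (y₀ := y n) (y₁ := y (n + 1)) (p := p) (f₀ := F (y n)) (f₁ := F (y (n + 1))) (fp := F p)
      (l₀ := lam n) (θ := lam (n + 1) / lam n) (g₀ := g (x n)) (g₁ := g (x (n + 1)))
      (g₂ := g (x (n + 2))) (gp := g p) hδ0 (div_pos (hlam0 _) (hlam0 _)).le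
      (by simpa using hy (n + 1) (by omega)) (hlam0 n).le (hstep n hn1 _) (hstep n hn1 _)
      (by rw [hθl]; exact hstep (n + 1) (by omega) p) (hmono _ _)
      (by rw [hθl]; simpa using hlin (n + 1) (by omega)) hα0.le
    rw [hθl] at hen
    have hQ := hform (lam (n + 1) / lam n) ‖x (n + 1) - x n‖ ‖x (n + 1) - y n‖
      ‖x (n + 2) - y (n + 1)‖ hρn.le
    have hθ1 : lam (n + 1) / lam n ≤ 1 := (div_le_one (hlam0 n)).2 (hlamanti n hn)
    have h1 : lam (n + 1) / lam n / δ * ‖x (n + 2) - x (n + 1)‖ ^ 2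
        ≤ 1 / δ * ‖x (n + 2) - x (n + 1)‖ ^ 2 := by gcongr
    have h2 : δ * (lam (n + 1) * G p (x n)) ≤ (1 + δ) * (lam n * G p (x n)) := by
      have h3 := mul_le_mul_of_nonneg_right (hlamanti n hn) (hG p hp (x n))
      have h4 := mul_le_mul_of_nonneg_left h3 hδ0.le
      have h5 := mul_nonneg (hlam0 n).le (hG p hp (x n))
      linarith
    have h6 : lam (n + 1) / lam n / δ * δ ^ 2 = lam (n + 1) / lam n * δ := by field_simp
    have h7 : lam (n + 1) / lam n / δ * (δ ^ 2 * ‖x (n + 1) - x n‖ ^ 2)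
      = lam (n + 1) / lam n * δ * ‖x (n + 1) - x n‖ ^ 2 := by rw [← mul_assoc, h6]
    rw [mul_sub, mul_sub, h7] at hen
    simp only [V, G, show n + 1 + 1 = n + 2 from rfl] at h2 ⊢
    linarith
  obtain ⟨p₀, hp₀⟩ := hSne
  obtain ⟨⟨m₀, hm₀⟩, hd⟩ := hVconv p₀ hp₀
  have hd2 : Filter.Tendsto (fun n => ‖x (n + 1) - x n‖ ^ 2) Filter.atTop (nhds 0) := by
    have := hd.const_mul η⁻¹
    rw [mul_zero] at this
    refine this.congr fun n => ?_
    field_simp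
  have hd1 : Filter.Tendsto (fun n => ‖x (n + 1) - x n‖) Filter.atTop (nhds 0) := by
    have := hd2.sqrt
    rw [Real.sqrt_zero] at this
    exact this.congr fun n => Real.sqrt_sq (norm_nonneg _)
  have he : Filter.Tendsto (fun n => ‖x (n + 1) - y n‖) Filter.atTop (nhds 0) := by
    rw [← Filter.tendsto_add_atTop_iff_nat 1]
    have hub := (hd1.comp (Filter.tendsto_add_atTop_nat 1)).add (hd1.const_mul δ)
    rw [mul_zero, add_zero] at hub
    refine squeeze_zero (fun _ => norm_nonneg _) (fun n => ?_) hub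
    have : x (n + 1 + 1) - y (n + 1) = (x (n + 1 + 1) - x (n + 1)) - δ • (x (n + 1) - x n) := by
      rw [hy (n + 1) (by omega), Nat.add_sub_cancel]; abel
    rw [this]
    refine (norm_sub_le _ _).trans ?_
    rw [norm_smul, Real.norm_of_nonneg hδ0.le]
    rfl
  obtain ⟨C, hC⟩ : ∃ C, ∀ n, ‖x n‖ ≤ C := by
    obtain ⟨B, hB⟩ := hm₀.bddAbove_range
    refine ⟨max ‖x 0‖ (Real.sqrt (B + 1 / δ * M ^ 2) + ‖p₀‖), fun n => ?_⟩
    rcases n with _ | n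
    · exact le_max_left _ _
    refine le_max_of_le_right ?_
    have h1 : ‖x (n + 1) - p₀‖ ≤ Real.sqrt (B + 1 / δ * M ^ 2) := by
      apply Real.le_sqrt_of_sq_le
      have := hVlow p₀ hp₀ n
      have := hB ⟨n, rfl⟩
      linarith
    have := norm_sub_norm_le (x (n + 1)) p₀
    linarith
  have hres : ∀ z, ∃ ε : ℕ → ℝ, Filter.Tendsto ε Filter.atTop (nhds 0) ∧
      ∀ᶠ n in Filter.atTop, G z (x n) ≤ ε n := by
    intro z
    let ε : ℕ → ℝ := fun n => ‖x (n + 1) - x n‖ * (C + ‖z‖) / τ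
      + L * (‖x (n + 1) - y n‖ + (C + ‖z‖)) * ‖x (n + 1) - y n‖
    have hε : Filter.Tendsto ε Filter.atTop (nhds 0) := by
      simpa using ((hd1.mul_const (C + ‖z‖)).div_const τ).add
        (((he.add_const (C + ‖z‖)).const_mul L).mul he)
    refine ⟨fun n => ε (n - 1), hε.comp (Filter.tendsto_sub_atTop_nat 1), ?_⟩
    filter_upwards [Filter.eventually_ge_atTop 2] with n hn
    obtain ⟨k, rfl⟩ : ∃ k, n = k + 1 := ⟨n - 1, by omega⟩
    exact step_residual_bound hL hmono hlip hτ (hlam k)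
      ((norm_sub_le _ _).trans (by gcongr; exact hC _)) (hstep k (by omega) z)
  refine exists_weak_limit_of_fejer hC ?_ ?_
  · intro p hp
    obtain ⟨⟨m, hm⟩, -⟩ := hVconv p hp
    obtain ⟨ε, hε, hle⟩ := hres p
    have hG0 : Filter.Tendsto (fun n => G p (x n)) Filter.atTop (nhds 0) :=
      tendsto_of_tendsto_of_tendsto_of_le_of_le' tendsto_const_nhds hε
        (Filter.Eventually.of_forall fun n => hG p hp _) hle
    refine ⟨m, (Filter.tendsto_add_atTop_iff_nat 1).1 ?_⟩
    have := ((hm.sub ((hℓ.mul hG0).const_mul (2 * (1 + δ)))).sub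
      (hd2.const_mul (1 - 1 / δ))).sub ((he.pow 2).const_mul ν)
    simp only [mul_zero, sub_zero, ne_eq, OfNat.ofNat_ne_zero, not_false_eq_true, zero_pow] at this
    refine this.congr fun n => ?_
    simp only [V]
    ring
  · intro U q hU hq
    rw [hS]
    refine minty hFc hgconv fun z => le_of_forall_pos_le_add fun c hc => ?_
    rw [zero_add]
    obtain ⟨ε, hε, hle⟩ := hres z
    have hGconv : ConvexOn ℝ Set.univ (G z) := by
      refine ⟨convex_univ, fun u _ v _ s t hs ht hst => ?_⟩
      have h1 := hgconv.2 (Set.mem_univ u) (Set.mem_univ v) hs ht hst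
      have h2 : s • u + t • v - z = s • (u - z) + t • (v - z) := by
        rw [smul_sub, smul_sub, sub_add_sub_comm, ← add_smul, hst, one_smul]
      simp only [G, h2, inner_add_right, real_inner_smul_right, smul_eq_mul] at h1 ⊢
      have h3 : g z = s * g z + t * g z := by rw [← add_mul, hst, one_mul]
      linarith
    refine hGconv.le_of_weak_limit (by fun_prop) hq (hU ?_)
    filter_upwards [hle, hε.eventually (ge_mem_nhds hc)] with n h1 h2 using h1.trans h2
end

section
/- For all real numbers δ > 0 and λ > 2/(2δ+1), there exists a real number r with r < −1 such that r² = (1 − λ − δλ)·r + δλ; explicitly, r = ( s − √(s² + 4δλ) )/2 with s = 1 − (1+δ)λ works. -/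
/-- for δ > 0 and λ > 2/(2δ+1), the characteristic polynomial
t² − (1−λ−δλ)t − δλ has a real root r < −1; explicitly r = (s − √(s²+4δλ))/2 with
s = 1 − (1+δ)λ. -/
theorem stmt14 (δ lam : ℝ) (hδ : 0 < δ) (hlam : 2 / (2 * δ + 1) < lam) :
    ∃ r : ℝ, r < -1 ∧ r ^ 2 = (1 - lam - δ * lam) * r + δ * lam ∧
      r = ((1 - (1 + δ) * lam) -
        Real.sqrt ((1 - (1 + δ) * lam) ^ 2 + 4 * δ * lam)) / 2 := by
  have hd : 0 < 2 * δ + 1 := by linarith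
  have hlam' : 2 < lam * (2 * δ + 1) := (div_lt_iff₀ hd).mp hlam
  have hlam_pos : 0 < lam := (div_pos two_pos hd).trans hlam
  have hsq := Real.sq_sqrt
    (show 0 ≤ (1 - (1 + δ) * lam) ^ 2 + 4 * δ * lam by positivity)
  have hlt : (1 - (1 + δ) * lam) + 2 <
      Real.sqrt ((1 - (1 + δ) * lam) ^ 2 + 4 * δ * lam) :=
    Real.lt_sqrt_of_sq_lt (by linarith)
  exact ⟨_, by linarith, by linarith, rfl⟩
end

section
/- For all real numbers δ > 0 and λ > 2/(2δ+1), there exists a sequence x : ℕ → ℝ satisfying x(n+1) = (1 − λ − δλ)·x(n) + δλ·x(n−1) for all n ≥ 1 such that |x(n)| → ∞ as n → ∞. In particular, the proximal extrapolated gradient iteration with constant step size λ > 2/(2δ+1) applied to min_{x∈ℝ} ½x² does not converge for all initial data. -/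
/-- A monic real quadratic that is negative at `-1` has a root below `-1`. -/
lemma exists_root_lt_neg_one {b c : ℝ} (hc : 0 ≤ c) (h : b + 1 < c) :
    ∃ r : ℝ, r < -1 ∧ r ^ 2 = b * r + c := by
  have hs : √(b ^ 2 + 4 * c) ^ 2 = b ^ 2 + 4 * c := Real.sq_sqrt (by positivity)
  have hlt : b + 2 < √(b ^ 2 + 4 * c) := Real.lt_sqrt_of_sq_lt (by linarith)
  exact ⟨(b - √(b ^ 2 + 4 * c)) / 2, by linarith, by linarith⟩

/-- for δ > 0 and λ > 2/(2δ+1), there is a sequence satisfying the PEG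
recursion x(n+1) = (1−λ−δλ)x(n) + δλ·x(n−1) with |x(n)| → ∞, so the method with constant
step size λ > 2/(2δ+1) applied to min ½x² does not converge for all initial data. -/
theorem stmt15 (δ lam : ℝ) (hδ : 0 < δ) (hlam : 2 / (2 * δ + 1) < lam) :
    ∃ x : ℕ → ℝ,
      (∀ n : ℕ, 1 ≤ n → x (n + 1) = (1 - lam - δ * lam) * x n + δ * lam * x (n - 1)) ∧
      Filter.Tendsto (fun n => |x n|) Filter.atTop Filter.atTop := by
  have hpos : 0 < lam := lt_trans (by positivity) hlam
  rw [div_lt_iff₀ (by positivity)] at hlam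
  obtain ⟨r, hr, hroot⟩ := exists_root_lt_neg_one (b := 1 - lam - δ * lam) (c := δ * lam)
    (by positivity) (by linarith)
  refine ⟨fun n => r ^ n, fun n hn => ?_, ?_⟩
  · obtain ⟨k, rfl⟩ := Nat.exists_eq_add_of_le' hn
    simp only [Nat.add_sub_cancel]
    linear_combination r ^ k * hroot
  · simp only [abs_pow]
    exact tendsto_pow_atTop_atTop_of_one_lt (lt_abs.2 (Or.inr (by linarith)))
end
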